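/- Let ψ : ℝ² → ℝ² be a bijective linear map and let N := G_{ψ(R_k)} be the polygonal norm with unit ball ψ(R_k). Let P : [0, L_n] → ℝ² and Q : [0, M_m] → ℝ² be the unit-speed parametrizations under N of two polygonal curves, and define h(z) := N(P(z₁) − Q(z₂)). Then for every cell border B, the function t ↦ opt_h((0,0), B(t)) is piecewise quadratic: its domain can be partitioned into finitely many intervals on each of which the function agrees with a polynomial of degree at most 2. -/

import Mathlib

open Pointwise

/-- The gauge (Minkowski functional) of a set `K ⊆ ℝ²`:
`G_K(z) = inf {λ ≥ 0 : z ∈ λK}`. -/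
noncomputable def gaugeFn (K : Set (ℝ × ℝ)) (z : ℝ × ℝ) : ℝ :=
  sInf {l : ℝ | 0 ≤ l ∧ z ∈ l • K}

/-- `θ_r = 2πr/k`. -/
noncomputable def theta (k : ℕ) (r : ℤ) : ℝ := 2 * Real.pi * (r : ℝ) / (k : ℝ)

/-- `v_r = (cos θ_r, sin θ_r)`. -/
noncomputable def vtx (k : ℕ) (r : ℤ) : ℝ × ℝ :=
  (Real.cos (theta k r), Real.sin (theta k r))

/-- The regular `k`-gon `R_k`: the convex hull of `{v_1, …, v_k}`. -/
noncomputable def Rgon (k : ℕ) : Set (ℝ × ℝ) :=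
  convexHull ℝ {z : ℝ × ℝ | ∃ r : ℤ, 1 ≤ r ∧ r ≤ (k : ℤ) ∧ z = vtx k r}

/-- `P` is the unit-speed parametrization under the norm `N` of the polygonal curve
with vertices `p 0, …, p n` (consecutive vertices distinct) and arc lengths `L`. -/
def IsUnitSpeedParam (N : ℝ × ℝ → ℝ) (n : ℕ) (p : ℕ → ℝ × ℝ) (L : ℕ → ℝ)
    (P : ℝ → ℝ × ℝ) : Prop :=
  (∀ i : ℕ, 1 ≤ i → i ≤ n → p i ≠ p (i - 1)) ∧
  (∀ i : ℕ, L i = ∑ i' ∈ Finset.Icc 1 i, N (p i' - p (i' - 1))) ∧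
  (∀ i : ℕ, 1 ≤ i → i ≤ n → ∀ s ∈ Set.Icc (L (i - 1)) (L i),
    P s = p (i - 1) + ((s - L (i - 1)) / N (p i - p (i - 1))) • (p i - p (i - 1)))

/-- A cell border of the parameter space of two polygonal curves with arc lengths
`L` (of `n` segments) and `M` (of `m` segments): either a top/bottom border
`B(t) = (t, M j)` on `[L (i−1), L i]`, or a left/right border `B(t) = (L i, t)` on
`[M (j−1), M j]`. -/
def IsCellBorder (n m : ℕ) (L M : ℕ → ℝ) (lo hi : ℝ) (B : ℝ → ℝ × ℝ) : Prop :=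
  (∃ i j : ℕ, 1 ≤ i ∧ i ≤ n ∧ j ≤ m ∧ lo = L (i - 1) ∧ hi = L i ∧
      ∀ t : ℝ, B t = (t, M j)) ∨
  (∃ i j : ℕ, i ≤ n ∧ 1 ≤ j ∧ j ≤ m ∧ lo = M (j - 1) ∧ hi = M j ∧
      ∀ t : ℝ, B t = (L i, t))

/-- An `(x,y)`-path: a function `f : [x₁+x₂, y₁+y₂] → ℝ` with `f(x₁+x₂) = x₁`,
`f(y₁+y₂) = y₁` such that both `f` and `s ↦ s − f s` are monotone non-decreasing. -/
def IsPath (x y : ℝ × ℝ) (f : ℝ → ℝ) : Prop :=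
  x.1 ≤ y.1 ∧ x.2 ≤ y.2 ∧
  f (x.1 + x.2) = x.1 ∧ f (y.1 + y.2) = y.1 ∧
  MonotoneOn f (Set.Icc (x.1 + x.2) (y.1 + y.2)) ∧
  MonotoneOn (fun s => s - f s) (Set.Icc (x.1 + x.2) (y.1 + y.2))

/-- The cost of an `(x,y)`-path `f` with respect to `h`. -/
noncomputable def pathCost (h : ℝ × ℝ → ℝ) (x y : ℝ × ℝ) (f : ℝ → ℝ) : ℝ :=
  ∫ s in (x.1 + x.2)..(y.1 + y.2), h (f s, s - f s)

/-- `opt_h(x,y)`: the infimum of the costs of all `(x,y)`-paths. -/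
noncomputable def optCost (h : ℝ × ℝ → ℝ) (x y : ℝ × ℝ) : ℝ :=
  sInf (pathCost h x y '' {f : ℝ → ℝ | IsPath x y f})

/-- `F` is piecewise quadratic on `[lo, hi]`: the interval can be partitioned into
finitely many intervals on each of which `F` agrees with a polynomial of degree ≤ 2. -/
def PiecewiseQuadraticOn (F : ℝ → ℝ) (lo hi : ℝ) : Prop :=
  ∃ (mm : ℕ) (a : ℕ → ℝ), a 0 = lo ∧ a mm = hi ∧
    (∀ j : ℕ, j < mm → a j ≤ a (j + 1)) ∧
    ∀ j : ℕ, j < mm → ∃ c0 c1 c2 : ℝ, ∀ t ∈ Set.Icc (a j) (a (j + 1)),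
      F t = c2 * t ^ 2 + c1 * t + c0

/-- Induction over the subdivision of an interval by finitely many points: a property that holds
on intervals with no subdivision point inside and is additive under concatenation holds on every
interval, with a counter that depends only on the number of points. -/
theorem interval_induction {I : Type*} [Fintype I] (τ : I → ℝ) (A : ℕ → ℝ → ℝ → Prop)
    (base : ∀ a b, a ≤ b → (∀ i, ¬ (a < τ i ∧ τ i < b)) → A 1 a b)
    (glue : ∀ n n' a b c, a ≤ b → b ≤ c → A n a b → A n' b c → A (n + n') a c)
    (a b : ℝ) (hab : a ≤ b) : A (2 ^ Fintype.card I) a b := by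
  classical
  suffices H : ∀ S : Finset I, ∀ a b, a ≤ b → (∀ i, a < τ i → τ i < b → i ∈ S) →
      A (2 ^ S.card) a b from H Finset.univ a b hab (fun i _ _ => Finset.mem_univ i)
  intro S
  induction S using Finset.induction_on with
  | empty =>
    intro a b hab hS
    simpa using base a b hab (fun i hi => by simpa using hS i hi.1 hi.2)
  | insert σ S hσ ih =>
    intro a b hab hS
    rw [Finset.card_insert_of_notMem hσ, pow_succ, mul_two]
    by_cases h : a < τ σ ∧ τ σ < b
    · refine glue _ _ a (τ σ) b h.1.le h.2.le (ih _ _ h.1.le fun i h1 h2 => ?_)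
        (ih _ _ h.2.le fun i h1 h2 => ?_)
      · refine Finset.mem_of_mem_insert_of_ne (hS i h1 (h2.trans h.2)) ?_
        rintro rfl
        exact lt_irrefl _ h2
      · refine Finset.mem_of_mem_insert_of_ne (hS i (h.1.trans h1) h2) ?_
        rintro rfl
        exact lt_irrefl _ h1
    · refine glue _ _ a b b hab le_rfl (ih _ _ hab fun i h1 h2 => ?_)
        (ih _ _ le_rfl fun i h1 h2 => absurd (h1.trans h2) (lt_irrefl _))
      refine Finset.mem_of_mem_insert_of_ne (hS i h1 h2) ?_
      rintro rfl
      exact h ⟨h1, h2⟩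

theorem PiecewiseQuadraticOn.trans {F : ℝ → ℝ} {a b c : ℝ}
    (h₁ : PiecewiseQuadraticOn F a b) (h₂ : PiecewiseQuadraticOn F b c) :
    PiecewiseQuadraticOn F a c := by
  obtain ⟨m₁, s₁, h10, h1m, h1le, h1q⟩ := h₁
  obtain ⟨m₂, s₂, h20, h2m, h2le, h2q⟩ := h₂
  have left : ∀ j, j ≤ m₁ → (if j ≤ m₁ then s₁ j else s₂ (j - m₁)) = s₁ j := by
    intro j hj
    simp [hj]
  have right : ∀ j, (if m₁ + j ≤ m₁ then s₁ (m₁ + j) else s₂ (m₁ + j - m₁)) = s₂ j := by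
    intro j
    rcases Nat.eq_zero_or_pos j with rfl | hj
    · simp [h1m, h20]
    · rw [if_neg (by omega), Nat.add_sub_cancel_left]
  refine ⟨m₁ + m₂, fun j => if j ≤ m₁ then s₁ j else s₂ (j - m₁), ?_, ?_, ?_, ?_⟩
  · exact (left 0 (Nat.zero_le _)).trans h10
  · exact (right m₂).trans h2m
  · intro j hj
    rcases lt_or_ge j m₁ with h | h
    · simp only [left j h.le, left (j + 1) h]
      exact h1le j h
    · obtain ⟨i, rfl⟩ := Nat.exists_eq_add_of_le h
      have := right (i + 1)
      rw [← add_assoc] at this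
      simp only [right i, this]
      exact h2le i (by omega)
  · intro j hj
    rcases lt_or_ge j m₁ with h | h
    · simp only [left j h.le, left (j + 1) h]
      exact h1q j h
    · obtain ⟨i, rfl⟩ := Nat.exists_eq_add_of_le h
      have := right (i + 1)
      rw [← add_assoc] at this
      simp only [right i, this]
      exact h2q i (by omega)

theorem PiecewiseQuadraticOn.single {F : ℝ → ℝ} {a b : ℝ} (hab : a ≤ b) (c0 c1 c2 : ℝ)
    (h : ∀ t ∈ Set.Icc a b, F t = c2 * t ^ 2 + c1 * t + c0) : PiecewiseQuadraticOn F a b := by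
  refine ⟨1, fun j => if j = 0 then a else b, by simp, by simp, ?_, ?_⟩
  · intro j hj
    obtain rfl : j = 0 := by omega
    simpa using hab
  · intro j hj
    obtain rfl : j = 0 := by omega
    exact ⟨c0, c1, c2, by simpa using h⟩

open Polynomial in
/-- A continuous function which takes at every point the value of one of finitely many quadratic
polynomials is piecewise quadratic. -/
theorem piecewiseQuadraticOn_of_finite_selection {J : Type*} [Fintype J] (p : J → ℝ[X])
    (hp : ∀ j, (p j).natDegree ≤ 2) {F : ℝ → ℝ} {lo hi : ℝ} (hle : lo ≤ hi)
    (hF : ContinuousOn F (Set.Icc lo hi))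
    (hsel : ∀ t ∈ Set.Icc lo hi, ∃ j, F t = (p j).eval t) :
    PiecewiseQuadraticOn F lo hi := by
  classical
  have quad : ∀ j t, (p j).eval t = (p j).coeff 2 * t ^ 2 + (p j).coeff 1 * t + (p j).coeff 0 := by
    intro j t
    rw [Polynomial.eval_eq_sum_range' (Nat.lt_succ_of_le (hp j))]
    simp [Finset.sum_range_succ]
    ring
  let T : Finset ℝ := Finset.univ.biUnion fun ij : J × J => (p ij.1 - p ij.2).roots.toFinset
  have key := interval_induction (fun x : T => (x : ℝ))
    (fun _ a b => lo ≤ a → b ≤ hi → PiecewiseQuadraticOn F a b) ?_ ?_ lo hi hle le_rfl le_rfl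
  · exact key
  · intro a b hab hT hla hbh
    rcases hab.eq_or_lt with rfl | hlt
    · exact PiecewiseQuadraticOn.single le_rfl (F a) 0 0 (by
        intro t ht
        obtain rfl : t = a := le_antisymm ht.2 ht.1
        simp)
    have hsub : Set.Icc a b ⊆ Set.Icc lo hi := Set.Icc_subset_Icc hla hbh
    have hFab := hF.mono hsub
    obtain ⟨j, hj⟩ := hsel ((a + b) / 2) (hsub ⟨by linarith, by linarith⟩)
    have hne : ∀ i, p i ≠ p j → ∀ s ∈ Set.Ioo a b, (p i).eval s ≠ (p j).eval s := by
      intro i hij s hs heq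
      refine hT ⟨s, ?_⟩ hs
      refine Finset.mem_biUnion.2 ⟨(i, j), Finset.mem_univ _, ?_⟩
      simp [sub_ne_zero.2 hij, heq]
    have closed : ∀ i, IsClosed {s | s ∈ Set.Icc a b ∧ F s = (p i).eval s} := by
      intro i
      have := (hFab.sub (p i).continuous.continuousOn).preimage_isClosed_of_isClosed
        isClosed_Icc (isClosed_singleton (x := (0 : ℝ)))
      convert this using 1
      ext s
      simp [sub_eq_zero]
    have hopen : Set.EqOn F (fun s => (p j).eval s) (Set.Ioo a b) := by
      by_contra hcon
      simp only [Set.EqOn, not_forall] at hcon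
      obtain ⟨x, hx, hxne⟩ := hcon
      have hU : IsClosed (⋃ i : {i // p i ≠ p j}, {s | s ∈ Set.Icc a b ∧ F s = (p i).eval s}) :=
        isClosed_iUnion_of_finite fun i => closed i
      have hpre := isPreconnected_closed_iff.1 (isPreconnected_Ioo (a := a) (b := b)) _ _
        (closed j) hU ?_ ?_ ?_
      · obtain ⟨s, hs, hs1, hs2⟩ := hpre
        obtain ⟨i, hi⟩ := Set.mem_iUnion.1 hs2
        exact hne i i.2 s hs (hi.2.symm.trans hs1.2)
      · intro s hs
        obtain ⟨i, hi⟩ := hsel s (hsub ⟨hs.1.le, hs.2.le⟩)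
        by_cases hij : p i = p j
        · exact Or.inl ⟨⟨hs.1.le, hs.2.le⟩, by rw [hi, hij]⟩
        · exact Or.inr (Set.mem_iUnion.2 ⟨⟨i, hij⟩, ⟨hs.1.le, hs.2.le⟩, hi⟩)
      · exact ⟨(a + b) / 2, ⟨by linarith, by linarith⟩, ⟨by linarith, by linarith⟩, hj⟩
      · refine ⟨x, hx, ?_⟩
        obtain ⟨i, hi⟩ := hsel x (hsub ⟨hx.1.le, hx.2.le⟩)
        refine Set.mem_iUnion.2 ⟨⟨i, fun hij => hxne ?_⟩, ⟨hx.1.le, hx.2.le⟩, hi⟩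
        rw [hi, hij]
    have hcl : Set.EqOn F (fun s => (p j).eval s) (Set.Icc a b) :=
      hopen.of_subset_closure hFab (p j).continuous.continuousOn Set.Ioo_subset_Icc_self
        (by rw [closure_Ioo hlt.ne])
    exact PiecewiseQuadraticOn.single hab _ _ _ fun t ht => (hcl ht).trans (quad j t)
  · intro _ _ a b c hab hbc h1 h2 hla hch
    exact (h1 hla (hbc.trans hch)).trans (h2 (hla.trans hab) hch)

theorem integral_affine (p r a b : ℝ) :
    ∫ s in a..b, (p * s + r) = ((p * a + r) + (p * b + r)) / 2 * (b - a) := by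
  rw [intervalIntegral.integral_add
    ((by fun_prop : Continuous fun s => p * s).intervalIntegrable _ _)
    (continuous_const.intervalIntegrable _ _), intervalIntegral.integral_const_mul,
    integral_id, intervalIntegral.integral_const, smul_eq_mul]
  ring

namespace IsPath

variable {x y z : ℝ × ℝ} {f g : ℝ → ℝ}

theorem le (hf : IsPath x y f) : x ≤ y := ⟨hf.1, hf.2.1⟩

theorem sum_le (hf : IsPath x y f) : x.1 + x.2 ≤ y.1 + y.2 := add_le_add hf.1 hf.2.1

theorem mem (hf : IsPath x y f) {s : ℝ} (hs : s ∈ Set.Icc (x.1 + x.2) (y.1 + y.2)) :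
    (f s, s - f s) ∈ Set.Icc x y := by
  obtain ⟨h1, h2, hx, hy, hm, hm'⟩ := hf
  have hle := hs.1.trans hs.2
  have a1 := hm ⟨le_rfl, hle⟩ hs hs.1
  have a2 := hm hs ⟨hle, le_rfl⟩ hs.2
  have a3 := hm' ⟨le_rfl, hle⟩ hs hs.1
  have a4 := hm' hs ⟨hle, le_rfl⟩ hs.2
  simp only [hx, hy] at a1 a2 a3 a4
  exact ⟨⟨a1, show x.2 ≤ s - f s by linarith⟩, ⟨a2, show s - f s ≤ y.2 by linarith⟩⟩

theorem continuousOn (hf : IsPath x y f) :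
    ContinuousOn f (Set.Icc (x.1 + x.2) (y.1 + y.2)) := by
  have : LipschitzOnWith 1 f (Set.Icc (x.1 + x.2) (y.1 + y.2)) := by
    refine LipschitzOnWith.of_dist_le_mul fun a ha b hb => ?_
    rw [NNReal.coe_one, one_mul, Real.dist_eq, Real.dist_eq]
    rcases le_total a b with h | h
    · have h1 := hf.2.2.2.2.1 ha hb h
      have h2 := hf.2.2.2.2.2 ha hb h
      simp only at h2
      rw [abs_of_nonpos (by linarith), abs_of_nonpos (by linarith)]
      linarith
    · have h1 := hf.2.2.2.2.1 hb ha h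
      have h2 := hf.2.2.2.2.2 hb ha h
      simp only at h2
      rw [abs_of_nonneg (by linarith), abs_of_nonneg (by linarith)]
      linarith
  exact this.continuousOn

theorem continuousOn_comp (hf : IsPath x y f) {h : ℝ × ℝ → ℝ} (hc : Continuous h) :
    ContinuousOn (fun s => h (f s, s - f s)) (Set.Icc (x.1 + x.2) (y.1 + y.2)) :=
  hc.comp_continuousOn (hf.continuousOn.prodMk (continuousOn_id.sub hf.continuousOn))

theorem intervalIntegrable (hf : IsPath x y f) {h : ℝ × ℝ → ℝ} (hc : Continuous h) {a b : ℝ}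
    (ha : x.1 + x.2 ≤ a) (hab : a ≤ b) (hb : b ≤ y.1 + y.2) :
    IntervalIntegrable (fun s => h (f s, s - f s)) MeasureTheory.volume a b := by
  refine ((hf.continuousOn_comp hc).mono ?_).intervalIntegrable
  rw [Set.uIcc_of_le hab]
  exact Set.Icc_subset_Icc ha hb

theorem of_slow (hxy : x ≤ y) (hx : f (x.1 + x.2) = x.1) (hy : f (y.1 + y.2) = y.1)
    (hf : ∀ a b, a ∈ Set.Icc (x.1 + x.2) (y.1 + y.2) → b ∈ Set.Icc (x.1 + x.2) (y.1 + y.2) →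
      a ≤ b → f a ≤ f b ∧ f b - f a ≤ b - a) : IsPath x y f := by
  refine ⟨hxy.1, hxy.2, hx, hy, fun a ha b hb hab => (hf a b ha hb hab).1,
    fun a ha b hb hab => ?_⟩
  have := (hf a b ha hb hab).2
  simp only
  linarith

theorem slow (hf : IsPath x y f) {a b : ℝ} (ha : a ∈ Set.Icc (x.1 + x.2) (y.1 + y.2))
    (hb : b ∈ Set.Icc (x.1 + x.2) (y.1 + y.2)) (hab : a ≤ b) :
    f a ≤ f b ∧ f b - f a ≤ b - a := by
  have h1 := hf.2.2.2.2.1 ha hb hab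
  have h2 := hf.2.2.2.2.2 ha hb hab
  simp only at h2
  exact ⟨h1, by linarith⟩

theorem restrict (hf : IsPath x y f) {a b : ℝ} (ha : x.1 + x.2 ≤ a) (hab : a ≤ b)
    (hb : b ≤ y.1 + y.2) : IsPath (f a, a - f a) (f b, b - f b) f := by
  have hsub : Set.Icc a b ⊆ Set.Icc (x.1 + x.2) (y.1 + y.2) := Set.Icc_subset_Icc ha hb
  have hs := hf.slow (hsub ⟨le_rfl, hab⟩) (hsub ⟨hab, le_rfl⟩) hab
  refine of_slow ⟨hs.1, show a - f a ≤ b - f b by linarith⟩ (by simp) (by simp) ?_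
  simp only [add_sub_cancel]
  exact fun c d hc hd hcd => hf.slow (hsub hc) (hsub hd) hcd

theorem concat (hf : IsPath x z f) (hg : IsPath z y g) :
    IsPath x y fun s => if s ≤ z.1 + z.2 then f s else g s := by
  have h1 := hf.sum_le
  have h2 := hg.sum_le
  refine of_slow (hf.le.trans hg.le) (by simp [h1, hf.2.2.1]) ?_ fun a b ha hb hab => ?_
  · rcases h2.eq_or_lt with h | h
    · have := hg.le
      have e1 : z.1 = y.1 := le_antisymm this.1 (by linarith [this.2])
      have hz := hf.2.2.2.1
      rw [if_pos h.ge, ← h, hz, e1]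
    · simp [not_le.2 h, hg.2.2.2.1]
  · split_ifs with hA hB hB
    · exact hf.slow ⟨ha.1, hA⟩ ⟨hb.1, hB⟩ hab
    · push Not at hB
      have e1 := hf.slow ⟨ha.1, hA⟩ ⟨h1, le_rfl⟩ hA
      have e2 := hg.slow ⟨le_rfl, h2⟩ ⟨hB.le, hb.2⟩ hB.le
      rw [hf.2.2.2.1] at e1
      rw [hg.2.2.1] at e2
      constructor <;> linarith
    · linarith
    · push Not at hA hB
      exact hg.slow ⟨hA.le, ha.2⟩ ⟨hB.le, hb.2⟩ hab

end IsPath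

theorem exists_isPath {x y : ℝ × ℝ} (hxy : x ≤ y) : ∃ f, IsPath x y f := by
  have h1 := hxy.1
  have h2 := hxy.2
  refine ⟨fun s => min (s - x.2) y.1, IsPath.of_slow hxy ?_ ?_ fun a b _ _ hab => ?_⟩
  · simp [h1]
  · exact min_eq_right (by linarith)
  · constructor
    · exact min_le_min (by linarith) le_rfl
    · rcases min_cases (a - x.2) y.1 with h | h <;> rcases min_cases (b - x.2) y.1 with h' | h' <;>
        linarith

theorem isPath_segment {x y : ℝ × ℝ} (hxy : x ≤ y) (hlt : x.1 + x.2 < y.1 + y.2) :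
    IsPath x y fun s => x.1 + (s - (x.1 + x.2)) * ((y.1 - x.1) / (y.1 + y.2 - (x.1 + x.2))) := by
  have h1 := hxy.1
  have h2 := hxy.2
  have hpos : 0 < y.1 + y.2 - (x.1 + x.2) := by linarith
  have hc0 : 0 ≤ (y.1 - x.1) / (y.1 + y.2 - (x.1 + x.2)) := div_nonneg (by linarith) hpos.le
  have hc1 : (y.1 - x.1) / (y.1 + y.2 - (x.1 + x.2)) ≤ 1 := by
    rw [div_le_one hpos]
    linarith
  refine IsPath.of_slow hxy (by simp) (by field_simp; ring) fun a b _ _ hab => ?_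
  constructor <;> nlinarith

section Opt

variable {h : ℝ × ℝ → ℝ} {x y z : ℝ × ℝ} {f : ℝ → ℝ}

theorem pathCost_nonneg (h0 : ∀ z, 0 ≤ h z) (hxy : x ≤ y) : 0 ≤ pathCost h x y f :=
  intervalIntegral.integral_nonneg (add_le_add hxy.1 hxy.2) fun _ _ => h0 _

theorem optCost_le (h0 : ∀ z, 0 ≤ h z) (hf : IsPath x y f) : optCost h x y ≤ pathCost h x y f := by
  refine csInf_le ⟨0, ?_⟩ ⟨f, hf, rfl⟩
  rintro _ ⟨g, hg, rfl⟩
  exact pathCost_nonneg h0 (IsPath.le hg)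

theorem le_optCost (hxy : x ≤ y) {C : ℝ} (hC : ∀ f, IsPath x y f → C ≤ pathCost h x y f) :
    C ≤ optCost h x y := by
  obtain ⟨f, hf⟩ := exists_isPath hxy
  refine le_csInf ⟨_, f, hf, rfl⟩ ?_
  rintro _ ⟨g, hg, rfl⟩
  exact hC g hg

theorem optCost_congr {h' : ℝ × ℝ → ℝ} (H : ∀ w ∈ Set.Icc x y, h w = h' w) :
    optCost h x y = optCost h' x y := by
  unfold optCost
  congr 1
  refine Set.image_congr fun f hf => ?_
  refine intervalIntegral.integral_congr fun s hs => H _ ?_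
  have hf : IsPath x y f := hf
  rw [Set.uIcc_of_le hf.sum_le] at hs
  exact hf.mem hs

theorem pathCost_concat (hc : Continuous h) {g : ℝ → ℝ} (hf : IsPath x z f) (hg : IsPath z y g) :
    pathCost h x y (fun s => if s ≤ z.1 + z.2 then f s else g s) =
      pathCost h x z f + pathCost h z y g := by
  have hp := hf.concat hg
  unfold pathCost
  rw [← intervalIntegral.integral_add_adjacent_intervals
    (hp.intervalIntegrable hc le_rfl hf.sum_le hg.sum_le)
    (hp.intervalIntegrable hc hf.sum_le hg.sum_le le_rfl)]
  congr 1
  · refine intervalIntegral.integral_congr fun s hs => ?_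
    rw [Set.uIcc_of_le hf.sum_le] at hs
    simp [hs.2]
  · refine intervalIntegral.integral_congr fun s hs => ?_
    rw [Set.uIcc_of_le hg.sum_le] at hs
    rcases hs.1.eq_or_lt with h | h
    · simp [← h, hf.2.2.2.1, hg.2.2.1]
    · simp [not_le.2 h]

theorem optCost_triangle (hc : Continuous h) (h0 : ∀ z, 0 ≤ h z) (hxz : x ≤ z) (hzy : z ≤ y) :
    optCost h x y ≤ optCost h x z + optCost h z y := by
  have key : optCost h x y - optCost h x z ≤ optCost h z y := by
    refine le_optCost hzy fun g hg => ?_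
    have : optCost h x y - pathCost h z y g ≤ optCost h x z := by
      refine le_optCost hxz fun f hf => ?_
      have := optCost_le h0 (hf.concat hg)
      rw [pathCost_concat hc hf hg] at this
      linarith
    linarith
  linarith

theorem optCost_self (h : ℝ × ℝ → ℝ) (x : ℝ × ℝ) : optCost h x x = 0 := by
  have : pathCost h x x '' {f | IsPath x x f} = {0} := by
    obtain ⟨f, hf⟩ := exists_isPath (le_refl x)
    refine Set.Subset.antisymm ?_ ?_
    · rintro _ ⟨g, -, rfl⟩
      simp [pathCost]
    · rintro _ rfl
      exact ⟨f, hf, by simp [pathCost]⟩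
  rw [optCost, this, csInf_singleton]

/-- Along a segment on which the height function is affine, the optimum is at most the cost of the
segment, given by the trapezoidal rule. -/
theorem optCost_le_segment (h0 : ∀ z, 0 ≤ h z) (hxy : x ≤ y) {A B C : ℝ}
    (H : ∀ t ∈ Set.Icc (0 : ℝ) 1, h (x + t • (y - x)) =
      A * (x + t • (y - x)).1 + B * (x + t • (y - x)).2 + C) :
    optCost h x y ≤ ((A * x.1 + B * x.2 + C) + (A * y.1 + B * y.2 + C)) / 2 *
      (y.1 + y.2 - (x.1 + x.2)) := by
  rcases (add_le_add hxy.1 hxy.2).eq_or_lt with he | hlt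
  · have e1 : x.1 = y.1 := le_antisymm hxy.1 (by linarith [hxy.2])
    have e2 : x.2 = y.2 := by linarith
    obtain rfl : x = y := Prod.ext e1 e2
    simp [optCost_self]
  refine (optCost_le h0 (isPath_segment hxy hlt)).trans_eq ?_
  have hpos : 0 < y.1 + y.2 - (x.1 + x.2) := by linarith
  unfold pathCost
  set d := y.1 + y.2 - (x.1 + x.2) with hd
  set c := (y.1 - x.1) / d with hcdef
  have hcd : c * d = y.1 - x.1 := div_mul_cancel₀ _ hpos.ne'
  have hint : Set.EqOn (fun s => h (x.1 + (s - (x.1 + x.2)) * c,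
      s - (x.1 + (s - (x.1 + x.2)) * c)))
      (fun s => (A * c + B * (1 - c)) * s + (A * (x.1 - (x.1 + x.2) * c) -
        B * (x.1 - (x.1 + x.2) * c) + C)) (Set.uIcc (x.1 + x.2) (y.1 + y.2)) := by
    intro s hs
    rw [Set.uIcc_of_le hlt.le] at hs
    have ht := H ((s - (x.1 + x.2)) / d) ⟨div_nonneg (by linarith [hs.1]) hpos.le,
      (div_le_one hpos).2 (by linarith [hs.2])⟩
    have hpt : x + ((s - (x.1 + x.2)) / d) • (y - x) =
        (x.1 + (s - (x.1 + x.2)) * c, s - (x.1 + (s - (x.1 + x.2)) * c)) := by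
      refine Prod.ext ?_ ?_
      · simp only [Prod.fst_add, Prod.smul_fst, Prod.fst_sub, smul_eq_mul, hcdef]
        ring
      · have : y.2 - x.2 = d - c * d := by rw [hcd]; linarith
        simp only [Prod.snd_add, Prod.smul_snd, Prod.snd_sub, smul_eq_mul, this]
        field_simp
        ring
    rw [hpt] at ht
    simp only at ht ⊢
    rw [ht]
    ring
  rw [intervalIntegral.integral_congr hint, integral_affine]
  have e1 : y.1 = x.1 + c * d := by rw [hcd]; ring
  have e2 : y.2 = x.2 + d - c * d := by linarith
  rw [e1, e2]
  ring

theorem pathCost_le_mul (hc : Continuous h) {C : ℝ} (hC : ∀ w ∈ Set.Icc x y, h w ≤ C)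
    (hf : IsPath x y f) : pathCost h x y f ≤ C * (y.1 + y.2 - (x.1 + x.2)) := by
  have := intervalIntegral.integral_mono_on hf.sum_le
    (hf.intervalIntegrable hc le_rfl hf.sum_le le_rfl)
    (intervalIntegrable_const (c := C)) fun s hs => hC _ (hf.mem hs)
  rw [intervalIntegral.integral_const, smul_eq_mul, mul_comm] at this
  exact this

theorem IsPath.truncate (hf : IsPath x y f) (hxz : x ≤ z) (hzy : z ≤ y) :
    IsPath x z (fun s => max (min (f s) z.1) (s - z.2)) ∧
    ∀ s ∈ Set.Icc (x.1 + x.2) (z.1 + z.2),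
      |max (min (f s) z.1) (s - z.2) - f s| ≤ max (y.1 - z.1) (y.2 - z.2) := by
  have hsum := add_le_add hzy.1 hzy.2
  have hsum' := add_le_add hxz.1 hxz.2
  refine ⟨IsPath.of_slow hxz ?_ ?_ fun a b ha hb hab => ?_, fun s hs => ?_⟩
  · have := hxz.1
    have := hxz.2
    rw [hf.2.2.1, min_eq_left hxz.1, max_eq_left (by linarith)]
  · have := hf.mem ⟨hsum', hsum⟩
    have h1 : z.1 + z.2 - f (z.1 + z.2) ≤ y.2 := this.2.2
    rw [max_eq_right]
    · ring
    · simp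
  · have := hf.slow (a := a) (b := b) ⟨ha.1, ha.2.trans hsum⟩ ⟨hb.1, hb.2.trans hsum⟩ hab
    constructor
    · exact max_le_max (min_le_min this.1 le_rfl) (by linarith)
    · rcases max_cases (min (f a) z.1) (a - z.2) with h | h <;>
      rcases max_cases (min (f b) z.1) (b - z.2) with h' | h' <;>
      rcases min_cases (f a) z.1 with h'' | h'' <;>
      rcases min_cases (f b) z.1 with h''' | h''' <;> linarith
  · have hm := hf.mem (s := s) ⟨hs.1, hs.2.trans hsum⟩
    have m1 : f s ≤ y.1 := hm.2.1
    have m2 : s - f s ≤ y.2 := hm.2.2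
    have := hzy.1
    have := hzy.2
    have l1 := le_max_left (y.1 - z.1) (y.2 - z.2)
    have l2 := le_max_right (y.1 - z.1) (y.2 - z.2)
    rw [abs_le]
    rcases max_cases (min (f s) z.1) (s - z.2) with h | h <;>
    rcases min_cases (f s) z.1 with h'' | h'' <;> constructor <;> linarith

theorem optCost_uniform_continuity (hc : Continuous h) (h0 : ∀ z, 0 ≤ h z) (x c : ℝ × ℝ)
    {ε : ℝ} (hε : 0 < ε) : ∃ δ > 0, ∀ z y : ℝ × ℝ, x ≤ z → z ≤ y → y ≤ c →
      y.1 - z.1 < δ → y.2 - z.2 < δ → |optCost h x y - optCost h x z| < ε := by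
  rcases (Set.Icc x c).eq_empty_or_nonempty with hempty | hne
  · refine ⟨1, one_pos, fun z y hz hzy hy => ?_⟩
    exact absurd (show y ∈ Set.Icc x c from ⟨hz.trans hzy, hy⟩) (by simp [hempty])
  obtain ⟨C, hC⟩ := (isCompact_Icc (a := x) (b := c)).exists_bound_of_continuousOn hc.continuousOn
  have hC0 : 0 ≤ C := by
    obtain ⟨w, hw⟩ := hne
    exact (norm_nonneg _).trans (hC w hw)
  set l := c.1 + c.2 - (x.1 + x.2) with hl
  have hl0 : 0 ≤ l := by
    obtain ⟨w, hw⟩ := hne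
    have := hw.1.trans hw.2
    linarith [this.1, this.2]
  have huc := (isCompact_Icc (a := x) (b := c)).uniformContinuousOn_of_continuous hc.continuousOn
  obtain ⟨δ, hδ, H⟩ := Metric.uniformContinuousOn_iff.1 huc (ε / (l + 1)) (by positivity)
  refine ⟨min δ (ε / (2 * C + 1)), lt_min hδ (by positivity), fun z y hxz hzy hyc h1 h2 => ?_⟩
  have hz1 := hzy.1
  have hz2 := hzy.2
  have up : optCost h x y ≤ optCost h x z + C * (y.1 + y.2 - (z.1 + z.2)) := by
    refine (optCost_triangle hc h0 hxz hzy).trans (add_le_add le_rfl ?_)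
    obtain ⟨f, hf⟩ := exists_isPath hzy
    refine (optCost_le h0 hf).trans (pathCost_le_mul hc (fun w hw => ?_) hf)
    exact (le_abs_self _).trans (hC w ⟨hxz.trans hw.1, hw.2.trans hyc⟩)
  have down : optCost h x z - ε / (l + 1) * l ≤ optCost h x y := by
    refine le_optCost (hxz.trans hzy) fun f hf => ?_
    obtain ⟨hg, hd⟩ := hf.truncate hxz hzy
    have hsum := add_le_add hxz.1 hxz.2
    have hsum' := add_le_add hzy.1 hzy.2
    have hi1 := hf.intervalIntegrable hc le_rfl hsum hsum'
    have e1 : pathCost h x z (fun s => max (min (f s) z.1) (s - z.2)) ≤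
        ∫ s in (x.1 + x.2)..(z.1 + z.2), (h (f s, s - f s) + ε / (l + 1)) := by
      refine intervalIntegral.integral_mono_on hsum
        (hg.intervalIntegrable hc le_rfl hsum le_rfl)
        (hi1.add intervalIntegrable_const) fun s hs => ?_
      have m1 := hf.mem (s := s) ⟨hs.1, hs.2.trans hsum'⟩
      have m2 := hg.mem hs
      have := H _ ⟨m2.1, m2.2.trans (hzy.trans hyc)⟩ _ ⟨m1.1, m1.2.trans hyc⟩ ?_
      · rw [Real.dist_eq] at this
        linarith [le_of_abs_le this.le]
      · have hds := hd s hs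
        have hm : max (y.1 - z.1) (y.2 - z.2) < δ :=
          (max_lt h1 h2).trans_le (min_le_left _ _)
        rw [Prod.dist_eq, max_lt_iff, Real.dist_eq, Real.dist_eq]
        refine ⟨hds.trans_lt hm, lt_of_le_of_lt (le_of_eq ?_) (hds.trans_lt hm)⟩
        simp only
        rw [← abs_neg]
        ring_nf
    rw [intervalIntegral.integral_add hi1 intervalIntegrable_const,
      intervalIntegral.integral_const, smul_eq_mul] at e1
    have e2 : ∫ s in (x.1 + x.2)..(z.1 + z.2), h (f s, s - f s) ≤ pathCost h x y f := by
      unfold pathCost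
      rw [← intervalIntegral.integral_add_adjacent_intervals hi1
        (hf.intervalIntegrable hc hsum hsum' le_rfl)]
      exact le_add_of_nonneg_right (intervalIntegral.integral_nonneg hsum' fun _ _ => h0 _)
    have e3 := optCost_le h0 hg
    have e4 : (z.1 + z.2 - (x.1 + x.2)) * (ε / (l + 1)) ≤ ε / (l + 1) * l := by
      rw [mul_comm]
      refine mul_le_mul_of_nonneg_left ?_ (by positivity)
      linarith [hyc.1, hyc.2]
    linarith
  have f1 : ε / (l + 1) * l < ε := by
    rw [div_mul_eq_mul_div, div_lt_iff₀ (by positivity)]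
    nlinarith
  have f2 : C * (y.1 + y.2 - (z.1 + z.2)) < ε := by
    have b1 := h1.trans_le (min_le_right _ _)
    have b2 := h2.trans_le (min_le_right _ _)
    have b3 : C * (y.1 + y.2 - (z.1 + z.2)) ≤ C * (2 * (ε / (2 * C + 1))) :=
      mul_le_mul_of_nonneg_left (by linarith) hC0
    refine b3.trans_lt ?_
    rw [← mul_assoc, mul_div_assoc', div_lt_iff₀ (by positivity)]
    nlinarith
  rw [abs_lt]
  constructor <;> linarith

end Opt

/-- A function on a real vector space is quadratic if it is the sum of a quadratic form, a linear
form and a constant. -/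
def IsQuadraticFn {E : Type*} [AddCommGroup E] [Module ℝ E] (q : E → ℝ) : Prop :=
  ∃ (B : E →ₗ[ℝ] E →ₗ[ℝ] ℝ) (l : E →ₗ[ℝ] ℝ) (c : ℝ), ∀ u, q u = B u u + l u + c

/-- A polyhedron is a finite intersection of closed half-spaces. -/
def IsPolyhedron {E : Type*} [AddCommGroup E] [Module ℝ E] (K : Set E) : Prop :=
  ∃ S : Set ((E →ₗ[ℝ] ℝ) × ℝ), S.Finite ∧ K = {u | ∀ a ∈ S, a.1 u ≤ a.2}

section Algebra

variable {E : Type*} [AddCommGroup E] [Module ℝ E]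

theorem IsPolyhedron.halfspace (a : E →ₗ[ℝ] ℝ) (b : ℝ) : IsPolyhedron {u | a u ≤ b} :=
  ⟨{(a, b)}, Set.finite_singleton _, by simp⟩

theorem IsPolyhedron.iInter {ι : Type*} [Finite ι] {K : ι → Set E}
    (h : ∀ i, IsPolyhedron (K i)) : IsPolyhedron {u | ∀ i, u ∈ K i} := by
  choose S hS hK using h
  refine ⟨⋃ i, S i, Set.finite_iUnion hS, ?_⟩
  ext u
  simp only [hK, Set.mem_ofPred_eq, Set.mem_iUnion]
  exact ⟨fun H a ⟨i, hi⟩ => H i a hi, fun H i a hi => H a ⟨i, hi⟩⟩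

theorem IsPolyhedron.inter {K K' : Set E} (h : IsPolyhedron K) (h' : IsPolyhedron K') :
    IsPolyhedron (K ∩ K') := by
  obtain ⟨S, hS, rfl⟩ := h
  obtain ⟨S', hS', rfl⟩ := h'
  refine ⟨S ∪ S', hS.union hS', ?_⟩
  ext u
  simp only [Set.mem_inter_iff, Set.mem_ofPred_eq, Set.mem_union]
  exact ⟨fun H a ha => ha.elim (H.1 a) (H.2 a), fun H => ⟨fun a ha => H a (.inl ha),
    fun a ha => H a (.inr ha)⟩⟩

theorem IsPolyhedron.preimage {E' : Type*} [AddCommGroup E'] [Module ℝ E'] {K : Set E}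
    (h : IsPolyhedron K) (f : E' →ₗ[ℝ] E) : IsPolyhedron (f ⁻¹' K) := by
  obtain ⟨S, hS, rfl⟩ := h
  refine ⟨(fun a => (a.1.comp f, a.2)) '' S, hS.image _, ?_⟩
  ext u
  exact ⟨fun H => by rintro _ ⟨a, ha, rfl⟩; exact H a ha, fun H a ha => H _ ⟨a, ha, rfl⟩⟩

theorem IsQuadraticFn.sum {ι : Type*} (s : Finset ι) {q : ι → E → ℝ}
    (h : ∀ i, IsQuadraticFn (q i)) : IsQuadraticFn fun u => ∑ i ∈ s, q i u := by
  choose B l c H using h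
  refine ⟨∑ i ∈ s, B i, ∑ i ∈ s, l i, ∑ i ∈ s, c i, fun u => ?_⟩
  simp [H, LinearMap.sum_apply, Finset.sum_add_distrib]

theorem IsQuadraticFn.affine_mul_affine (a b : E →ₗ[ℝ] ℝ) (c d : ℝ) :
    IsQuadraticFn fun u => (a u + c) * (b u + d) := by
  refine ⟨LinearMap.mk₂ ℝ (fun x y => a x * b y) ?_ ?_ ?_ ?_, d • a + c • b, c * d, fun u => ?_⟩
  · intros; simp; ring
  · intros; simp; ring
  · intros; simp; ring
  · intros; simp; ring
  · simp; ring

end Algebra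

open Polynomial in
/-- Parametric quadratic programming: if the feasible set of a quadratic program depends affinely
on a real parameter through equality constraints, then the optimal values are taken from
finitely many quadratic polynomials of the parameter. -/
theorem exists_finite_quadratic_minimum {E F : Type*} [NormedAddCommGroup E] [NormedSpace ℝ E]
    [FiniteDimensional ℝ E] [AddCommGroup F] [Module ℝ F] [TopologicalSpace F] [T1Space F]
    {K : Set E} (hK : IsPolyhedron K) (D : E →ₗ[ℝ] F) (hD : Continuous D) (d₀ d₁ : F)
    (hb : ∀ t : ℝ, Bornology.IsBounded {u | u ∈ K ∧ D u = d₀ + t • d₁})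
    {q : E → ℝ} (hq : IsQuadraticFn q) :
    ∃ S : Set ℝ[X], S.Finite ∧ (∀ f ∈ S, f.natDegree ≤ 2) ∧
      ∀ t : ℝ, (∃ u ∈ K, D u = d₀ + t • d₁) → ∃ f ∈ S, ∃ u ∈ K, D u = d₀ + t • d₁ ∧
        q u = f.eval t ∧ ∀ w ∈ K, D w = d₀ + t • d₁ → q u ≤ q w := by
  classical
  obtain ⟨S, hS, rfl⟩ := hK
  obtain ⟨B, l, c, hq⟩ := hq
  have : Finite S := hS
  have hqc : Continuous q := by
    have h1 : Continuous fun u => B u u := by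
      let B' : E →L[ℝ] E →L[ℝ] ℝ := LinearMap.toContinuousLinearMap
        ((LinearMap.toContinuousLinearMap (𝕜 := ℝ) (E := E) (F' := ℝ)).toLinearMap ∘ₗ B)
      exact B'.continuous.clm_apply continuous_id
    have h2 : Continuous l := l.continuous_of_finiteDimensional
    rw [show q = fun u => B u u + l u + c from funext hq]
    exact (h1.add h2).add continuous_const
  -- the linear system satisfied by a critical point whose active constraints are `I`
  let V : Set S → Submodule ℝ E := fun I =>
    (⨅ i ∈ I, LinearMap.ker (i : (E →ₗ[ℝ] ℝ) × ℝ).1) ⊓ LinearMap.ker D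
  have memV : ∀ I d, d ∈ V I ↔ (∀ i ∈ I, (i : (E →ₗ[ℝ] ℝ) × ℝ).1 d = 0) ∧ D d = 0 := by
    intro I d
    simp [V, Submodule.mem_iInf]
  let Λ : ∀ I : Set S, E →ₗ[ℝ] (I → ℝ) × F × (V I →ₗ[ℝ] ℝ) := fun I =>
    (LinearMap.pi fun i : I => (i.1 : (E →ₗ[ℝ] ℝ) × ℝ).1).prod
      (D.prod ((B + B.flip).compl₂ (V I).subtype))
  have left : ∀ I : Set S, ∃ G : (I → ℝ) × F × (V I →ₗ[ℝ] ℝ) →ₗ[ℝ] E,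
      LinearMap.ker (Λ I) = ⊥ → G.comp (Λ I) = LinearMap.id := by
    intro I
    by_cases h : LinearMap.ker (Λ I) = ⊥
    · obtain ⟨G, hG⟩ := (Λ I).exists_leftInverse_of_injective h
      exact ⟨G, fun _ => hG⟩
    · exact ⟨0, fun h' => absurd h' h⟩
  choose G hG using left
  let σ₀ : Set S → E := fun I => G I (fun i => (i.1 : (E →ₗ[ℝ] ℝ) × ℝ).2, d₀, -l.comp (V I).subtype)
  let σ₁ : Set S → E := fun I => G I (0, d₁, 0)
  let f : Set S → ℝ[X] := fun I => C (B (σ₁ I) (σ₁ I)) * X ^ 2 +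
    C (B (σ₀ I) (σ₁ I) + B (σ₁ I) (σ₀ I) + l (σ₁ I)) * X + C (B (σ₀ I) (σ₀ I) + l (σ₀ I) + c)
  refine ⟨Set.range f, Set.finite_range f, ?_, ?_⟩
  · rintro _ ⟨I, rfl⟩
    exact natDegree_quadratic_le
  rintro t ⟨u₀, hu₀K, hu₀D⟩
  let Kt : Set E := {u | (∀ a ∈ S, a.1 u ≤ a.2) ∧ D u = d₀ + t • d₁}
  have hKt : IsCompact Kt := by
    refine Metric.isCompact_of_isClosed_isBounded ?_ (hb t)
    refine IsClosed.inter ?_ (isClosed_singleton.preimage hD)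
    have h : IsClosed (⋂ a ∈ S, {u : E | a.1 u ≤ a.2}) := isClosed_biInter fun a _ =>
      isClosed_le a.1.continuous_of_finiteDimensional continuous_const
    have h' : (⋂ a ∈ S, {u : E | a.1 u ≤ a.2}) = {u | ∀ a ∈ S, a.1 u ≤ a.2} := by
      ext u
      simp
    rwa [h'] at h
  let act : E → Set S := fun u => {i | (i : (E →ₗ[ℝ] ℝ) × ℝ).1 u = (i : (E →ₗ[ℝ] ℝ) × ℝ).2}
  have expand : ∀ u d r, q (u + r • d) = q u + r * (B u d + B d u + l d) + r ^ 2 * B d d := by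
    intro u d r
    simp only [hq, map_add, map_smul, LinearMap.add_apply, LinearMap.smul_apply, smul_eq_mul]
    ring
  -- first-order condition
  have crit : ∀ u ∈ Kt, IsMinOn q Kt u → ∀ d ∈ V (act u), B u d + B d u + l d = 0 := by
    intro u hu hmin d hd
    rw [memV] at hd
    have hev : ∀ᶠ r : ℝ in nhds 0, u + r • d ∈ Kt := by
      have h1 : ∀ᶠ r : ℝ in nhds 0, ∀ i : S, (i : (E →ₗ[ℝ] ℝ) × ℝ).1 (u + r • d) ≤ i.1.2 := by
        rw [Filter.eventually_all]
        intro i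
        by_cases hi : i ∈ act u
        · refine Filter.Eventually.of_forall fun r => ?_
          rw [map_add, map_smul, hd.1 i hi, smul_zero, add_zero]
          exact hi.le
        · have hlt : i.1.1 u < i.1.2 := lt_of_le_of_ne (hu.1 i i.2) hi
          have hc : Continuous fun r : ℝ => i.1.1 (u + r • d) :=
            i.1.1.continuous_of_finiteDimensional.comp (by fun_prop)
          have := (hc.tendsto 0).eventually_lt_const (by simpa using hlt : _ < i.1.2)
          exact this.mono fun r hr => hr.le
      refine h1.mono fun r hr => ⟨fun a ha => hr ⟨a, ha⟩, ?_⟩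
      rw [map_add, map_smul, hd.2, smul_zero, add_zero, hu.2]
    have hloc : IsLocalMin (fun r : ℝ => q (u + r • d)) 0 := by
      refine hev.mono fun r hr => ?_
      simpa using hmin hr
    have hder : HasDerivAt (fun r : ℝ => q (u + r • d)) (B u d + B d u + l d) 0 := by
      have : (fun r : ℝ => q (u + r • d)) =
          fun r => q u + r * (B u d + B d u + l d) + r ^ 2 * B d d := funext (expand u d)
      rw [this]
      have := (((hasDerivAt_id (0 : ℝ)).mul_const (B u d + B d u + l d)).const_add (q u)).add
        (((hasDerivAt_id (0 : ℝ)).pow 2).mul_const (B d d))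
      exact (by simpa using this : HasDerivAt ((fun r => q u + r * (B u d + B d u + l d)) +
        fun r => r ^ 2 * B d d) (B u d + B d u + l d) 0)
    exact hloc.hasDerivAt_eq_zero hder
  -- a minimizer whose linear system is nondegenerate
  have nondeg : ∀ k : ℕ, ∀ u ∈ Kt, IsMinOn q Kt u → (act u)ᶜ.ncard = k →
      ∃ w ∈ Kt, IsMinOn q Kt w ∧ LinearMap.ker (Λ (act w)) = ⊥ := by
    intro k
    induction k using Nat.strong_induction_on with
    | _ k ih =>
      intro u hu hmin hk
      by_cases hker : LinearMap.ker (Λ (act u)) = ⊥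
      · exact ⟨u, hu, hmin, hker⟩
      obtain ⟨d, hdker, hd0⟩ := (Submodule.ne_bot_iff _).1 hker
      have hdA := congrArg Prod.fst (LinearMap.mem_ker.1 hdker)
      have hdD : D d = 0 := congrArg (fun x => x.2.1) (LinearMap.mem_ker.1 hdker)
      have hdB : ((B + B.flip).compl₂ (V (act u)).subtype) d = 0 :=
        congrArg (fun x => x.2.2) (LinearMap.mem_ker.1 hdker)
      have hdA' : ∀ i ∈ act u, i.1.1 d = 0 := fun i hi => congrFun hdA ⟨i, hi⟩
      have hdV : d ∈ V (act u) := (memV _ _).2 ⟨hdA', hdD⟩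
      have hBdd : B d d = 0 := by
        have := LinearMap.congr_fun hdB ⟨d, hdV⟩
        simp at this
        linarith
      have hqd : ∀ r : ℝ, q (u + r • d) = q u := by
        intro r
        rw [expand, crit u hu hmin d hdV, hBdd]
        ring
      have hDd : ∀ r : ℝ, D (u + r • d) = d₀ + t • d₁ := by
        intro r
        rw [map_add, map_smul, hdD, smul_zero, add_zero, hu.2]
      have hpos : ∃ i : S, 0 < i.1.1 d := by
        by_contra! hneg
        obtain ⟨R, hR⟩ := (hb t).exists_norm_le
        have hmem : ∀ r : ℝ, 0 ≤ r → ‖u + r • d‖ ≤ R := by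
          intro r hr
          refine hR _ ⟨fun a ha => ?_, hDd r⟩
          rw [map_add, map_smul, smul_eq_mul]
          nlinarith [hu.1 a ha, hneg ⟨a, ha⟩]
        have hdn : 0 < ‖d‖ := norm_pos_iff.2 hd0
        have hR0 : 0 ≤ R := (norm_nonneg _).trans (hmem 0 le_rfl)
        have h1 := hmem ((R + ‖u‖ + 1) / ‖d‖) (by positivity)
        have h2 : ‖((R + ‖u‖ + 1) / ‖d‖) • d‖ = R + ‖u‖ + 1 := by
          rw [norm_smul, Real.norm_of_nonneg (by positivity)]
          field_simp
        have h3 := norm_sub_le (u + ((R + ‖u‖ + 1) / ‖d‖) • d) u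
        rw [add_sub_cancel_left, h2] at h3
        linarith
      have : Fintype S := Fintype.ofFinite S
      obtain ⟨i₀, hi₀, hi₀min⟩ := Finset.exists_min_image
        (Finset.univ.filter fun i : S => 0 < i.1.1 d)
        (fun i => (i.1.2 - i.1.1 u) / i.1.1 d) (by
          obtain ⟨i, hi⟩ := hpos
          exact ⟨i, by simpa using hi⟩)
      simp only [Finset.mem_filter, Finset.mem_univ, true_and] at hi₀ hi₀min
      set r := (i₀.1.2 - i₀.1.1 u) / i₀.1.1 d with hr
      have hr0 : 0 ≤ r := div_nonneg (sub_nonneg.2 (hu.1 _ i₀.2)) hi₀.le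
      have hmem : u + r • d ∈ Kt := by
        refine ⟨fun a ha => ?_, hDd r⟩
        rw [map_add, map_smul, smul_eq_mul]
        rcases lt_or_ge 0 (a.1 d) with hpos | hneg
        · have := (le_div_iff₀ hpos).1 (hi₀min ⟨a, ha⟩ hpos)
          linarith
        · nlinarith [hu.1 a ha]
      refine ih _ ?_ (u + r • d) hmem (fun w hw => ?_) rfl
      · rw [← hk]
        refine Set.ncard_lt_ncard ?_ (Set.toFinite _)
        refine compl_lt_compl_iff_lt.2 ((Set.ssubset_iff_of_subset ?_).2 ?_)
        · intro i hi
          change i.1.1 (u + r • d) = i.1.2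
          rw [map_add, map_smul, hdA' i hi, smul_zero, add_zero]
          exact hi
        · refine ⟨i₀, ?_, fun h => hi₀.ne' (hdA' i₀ h)⟩
          change i₀.1.1 (u + r • d) = i₀.1.2
          rw [map_add, map_smul, smul_eq_mul, hr, div_mul_cancel₀ _ hi₀.ne']
          ring
      · simpa [hqd r] using hmin hw
  obtain ⟨u₁, hu₁, hmin₁⟩ := hKt.exists_isMinOn ⟨u₀, hu₀K, hu₀D⟩ hqc.continuousOn
  obtain ⟨u, hu, hmin, hker⟩ := nondeg _ u₁ hu₁ hmin₁ rfl
  have hsys : Λ (act u) u = (fun i => i.1.1.2, d₀, -l.comp (V (act u)).subtype) +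
      t • ((0, d₁, 0) : (act u → ℝ) × F × (V (act u) →ₗ[ℝ] ℝ)) := by
    refine Prod.ext ?_ (Prod.ext ?_ ?_)
    · funext i
      have hi : i.1.1.1 u = i.1.1.2 := i.2
      simpa [Λ] using hi
    · simpa [Λ] using hu.2
    · ext d
      have := crit u hu hmin d d.2
      simp [Λ]
      linarith
  have huσ : u = σ₀ (act u) + t • σ₁ (act u) := by
    have := LinearMap.congr_fun (hG (act u) hker) u
    rw [LinearMap.comp_apply, hsys, map_add, map_smul] at this
    exact this.symm
  refine ⟨f (act u), ⟨_, rfl⟩, u, hu.1, hu.2, ?_, fun w hw hw' => hmin ⟨hw, hw'⟩⟩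
  generalize act u = I at huσ
  rw [huσ, hq]
  simp only [f, map_add, map_smul, LinearMap.add_apply, LinearMap.smul_apply, smul_eq_mul,
    eval_add, eval_mul, eval_C, eval_pow, eval_X]
  ring

/-- A rectangle in the parameter space on which `h` is a maximum of finitely many affine functions
and, along every antidiagonal, decreases towards a fixed monotone line, the valley. -/
structure ValleyCell (J : Type*) (h : ℝ × ℝ → ℝ) where
  /-- lower left corner -/
  lo : ℝ × ℝ
  /-- upper right corner -/
  up : ℝ × ℝ
  /-- coefficients of the first coordinate -/
  A : J → ℝ
  /-- coefficients of the second coordinate -/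
  B : J → ℝ
  /-- constant coefficients -/
  C : J → ℝ
  /-- the valley meets the antidiagonal of sum `s` in the first coordinate `slope * s + offset` -/
  slope : ℝ
  /-- the offset of the valley -/
  offset : ℝ
  affine_le : ∀ w ∈ Set.Icc lo up, ∀ r, A r * w.1 + B r * w.2 + C r ≤ h w
  attained : ∀ w ∈ Set.Icc lo up, ∃ r, h w = A r * w.1 + B r * w.2 + C r
  slope_nonneg : 0 ≤ slope
  slope_le_one : slope ≤ 1
  valley : ∀ s a b, (a, s - a) ∈ Set.Icc lo up → (b, s - b) ∈ Set.Icc lo up →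
    (a ≤ b ∧ b ≤ slope * s + offset ∨ slope * s + offset ≤ b ∧ b ≤ a) →
    h (b, s - b) ≤ h (a, s - a)

namespace ValleyCell

variable {J : Type*} {h : ℝ × ℝ → ℝ}

/-- The affine function with index `r`. -/
def val (c : ValleyCell J h) (r : J) (w : ℝ × ℝ) : ℝ := c.A r * w.1 + c.B r * w.2 + c.C r

/-- The part of the cell where the affine function with index `r` is maximal. -/
def region (c : ValleyCell J h) (r : J) : Set (ℝ × ℝ) :=
  {w | w ∈ Set.Icc c.lo c.up ∧ ∀ r', c.val r' w ≤ c.val r w}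

/-- The cost of a segment in the region with index `r`. -/
noncomputable def stepCost (c : ValleyCell J h) (r : J) (x y : ℝ × ℝ) : ℝ :=
  (c.val r x + c.val r y) / 2 * (y.1 + y.2 - (x.1 + x.2))

theorem eq_val (c : ValleyCell J h) {r : J} {w : ℝ × ℝ} (hw : w ∈ c.region r) :
    h w = c.val r w := by
  obtain ⟨r', hr'⟩ := c.attained w hw.1
  exact le_antisymm (hr'.trans_le (hw.2 r')) (c.affine_le w hw.1 r)

theorem convex_region (c : ValleyCell J h) (r : J) : Convex ℝ (c.region r) := by
  intro x hx y hy a b ha hb hab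
  refine ⟨convex_Icc _ _ hx.1 hy.1 ha hb hab, fun r' => ?_⟩
  have h1 := mul_le_mul_of_nonneg_left (hx.2 r') ha
  have h2 := mul_le_mul_of_nonneg_left (hy.2 r') hb
  obtain rfl : b = 1 - a := by linarith
  simp only [val, Prod.fst_add, Prod.snd_add, Prod.smul_fst, Prod.smul_snd, smul_eq_mul] at *
  linarith

theorem optCost_le_stepCost (c : ValleyCell J h) (h0 : ∀ z, 0 ≤ h z) {r : J} {x y : ℝ × ℝ}
    (hxy : x ≤ y) (hx : x ∈ c.region r) (hy : y ∈ c.region r) :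
    optCost h x y ≤ c.stepCost r x y := by
  refine optCost_le_segment h0 hxy (A := c.A r) (B := c.B r) (C := c.C r) fun t ht => ?_
  exact c.eq_val ((c.convex_region r).add_smul_sub_mem hx hy ht)

end ValleyCell

section Chain

variable {κ J : Type*} {h : ℝ × ℝ → ℝ}

/-- A monotone chain of `n` segments, each contained in one region of a cell. -/
def IsMonotoneChain (cell : κ → ValleyCell J h) (n : ℕ) (z : ℕ → ℝ × ℝ) (ρ : ℕ → κ × J) : Prop :=
  ∀ i < n, z i ≤ z (i + 1) ∧ z i ∈ (cell (ρ i).1).region (ρ i).2 ∧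
    z (i + 1) ∈ (cell (ρ i).1).region (ρ i).2

/-- The cost of a chain of `n` segments. -/
noncomputable def chainCost (cell : κ → ValleyCell J h) (n : ℕ) (z : ℕ → ℝ × ℝ)
    (ρ : ℕ → κ × J) : ℝ :=
  ∑ i ∈ Finset.range n, (cell (ρ i).1).stepCost (ρ i).2 (z i) (z (i + 1))

/-- There is a chain of `n` segments from `x` to `y` of cost at most `c`. -/
def HasChain (cell : κ → ValleyCell J h) (n : ℕ) (x y : ℝ × ℝ) (c : ℝ) : Prop :=
  ∃ z ρ, z 0 = x ∧ z n = y ∧ IsMonotoneChain cell n z ρ ∧ chainCost cell n z ρ ≤ c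

variable {cell : κ → ValleyCell J h}

theorem HasChain.trans {n n' : ℕ} {x y w : ℝ × ℝ} {c c' : ℝ} (h₁ : HasChain cell n x y c)
    (h₂ : HasChain cell n' y w c') : HasChain cell (n + n') x w (c + c') := by
  obtain ⟨z, ρ, z0, zn, hz, hc⟩ := h₁
  obtain ⟨z', ρ', z0', zn', hz', hc'⟩ := h₂
  set Z : ℕ → ℝ × ℝ := fun i => if i ≤ n then z i else z' (i - n) with hZ
  set R : ℕ → κ × J := fun i => if i < n then ρ i else ρ' (i - n) with hR
  have Zl : ∀ i ≤ n, Z i = z i := fun i hi => if_pos hi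
  have Zr : ∀ i, Z (n + i) = z' i := by
    intro i
    rcases Nat.eq_zero_or_pos i with rfl | hi
    · rw [add_zero, Zl n le_rfl, zn, z0']
    · simp only [hZ]
      rw [if_neg (by omega), Nat.add_sub_cancel_left]
  have Rl : ∀ i < n, R i = ρ i := fun i hi => if_pos hi
  have Rr : ∀ i, R (n + i) = ρ' i := by
    intro i
    simp only [hR]
    rw [if_neg (by omega), Nat.add_sub_cancel_left]
  refine ⟨Z, R, (Zl 0 (Nat.zero_le _)).trans z0, (Zr n').trans zn', fun i hi => ?_, ?_⟩
  · rcases lt_or_ge i n with h | h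
    · rw [Zl i h.le, Zl (i + 1) h, Rl i h]
      exact hz i h
    · obtain ⟨j, rfl⟩ := Nat.exists_eq_add_of_le h
      rw [add_assoc, Zr j, Zr (j + 1), Rr j]
      exact hz' j (by omega)
  · refine le_trans (le_of_eq ?_) (add_le_add hc hc')
    unfold chainCost
    rw [Finset.sum_range_add]
    congr 1
    · refine Finset.sum_congr rfl fun i hi => ?_
      have hi := Finset.mem_range.1 hi
      rw [Zl i hi.le, Zl (i + 1) hi, Rl i hi]
    · refine Finset.sum_congr rfl fun i hi => ?_
      rw [add_assoc, Zr i, Zr (i + 1), Rr i]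

theorem HasChain.mono {n : ℕ} {x y : ℝ × ℝ} {c c' : ℝ} (h₁ : HasChain cell n x y c)
    (hc : c ≤ c') : HasChain cell n x y c' := by
  obtain ⟨z, ρ, z0, zn, hz, h⟩ := h₁
  exact ⟨z, ρ, z0, zn, hz, h.trans hc⟩

theorem optCost_le_chainCost (hc : Continuous h) (h0 : ∀ z, 0 ≤ h z) {n : ℕ} {z : ℕ → ℝ × ℝ}
    {ρ : ℕ → κ × J} (hz : IsMonotoneChain cell n z ρ) :
    z 0 ≤ z n ∧ optCost h (z 0) (z n) ≤ chainCost cell n z ρ := by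
  induction n with
  | zero => simp [chainCost, optCost_self]
  | succ n ih =>
    obtain ⟨ih1, ih2⟩ := ih fun i hi => hz i (by omega)
    obtain ⟨h1, h2, h3⟩ := hz n (by omega)
    refine ⟨ih1.trans h1, (optCost_triangle hc h0 ih1 h1).trans ?_⟩
    rw [chainCost, Finset.sum_range_succ]
    exact add_le_add ih2 ((cell (ρ n).1).optCost_le_stepCost h0 h1 h2 h3)

end Chain

/-- Two affine functions are comparable on an interval whose interior does not contain their
crossing point. -/
theorem affine_le_or_le {p q p' q' a b : ℝ}
    (h : ¬ (a < (q' - q) / (p - p') ∧ (q' - q) / (p - p') < b)) :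
    (∀ s ∈ Set.Icc a b, p * s + q ≤ p' * s + q') ∨
      ∀ s ∈ Set.Icc a b, p' * s + q' ≤ p * s + q := by
  by_contra! hcon
  obtain ⟨⟨s, hs, h1⟩, ⟨t, ht, h2⟩⟩ := hcon
  refine h ?_
  rcases lt_trichotomy (p - p') 0 with hp | hp | hp
  · have e1 : s < (q' - q) / (p - p') := by rw [lt_div_iff_of_neg hp]; linarith
    have e2 : (q' - q) / (p - p') < t := by rw [div_lt_iff_of_neg hp]; linarith
    exact ⟨hs.1.trans_lt e1, e2.trans_le ht.2⟩
  · obtain rfl : p = p' := by linarith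
    linarith
  · have e1 : (q' - q) / (p - p') < s := by rw [div_lt_iff₀ hp]; linarith
    have e2 : t < (q' - q) / (p - p') := by rw [lt_div_iff₀ hp]; linarith
    exact ⟨ht.1.trans_lt e2, e1.trans_le hs.2⟩

theorem exists_eq_max {I : Type*} {e : I → ℝ → ℝ} {S : Set ℝ}
    (H : ∀ i j, (∀ s ∈ S, e i s ≤ e j s) ∨ ∀ s ∈ S, e j s ≤ e i s) {F G : ℝ → ℝ}
    (hF : ∃ i, ∀ s ∈ S, F s = e i s) (hG : ∃ i, ∀ s ∈ S, G s = e i s) :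
    ∃ i, ∀ s ∈ S, max (F s) (G s) = e i s := by
  obtain ⟨i, hi⟩ := hF
  obtain ⟨j, hj⟩ := hG
  rcases H i j with h | h
  · exact ⟨j, fun s hs => by rw [hi s hs, hj s hs, max_eq_right (h s hs)]⟩
  · exact ⟨i, fun s hs => by rw [hi s hs, hj s hs, max_eq_left (h s hs)]⟩

theorem exists_eq_min {I : Type*} {e : I → ℝ → ℝ} {S : Set ℝ}
    (H : ∀ i j, (∀ s ∈ S, e i s ≤ e j s) ∨ ∀ s ∈ S, e j s ≤ e i s) {F G : ℝ → ℝ}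
    (hF : ∃ i, ∀ s ∈ S, F s = e i s) (hG : ∃ i, ∀ s ∈ S, G s = e i s) :
    ∃ i, ∀ s ∈ S, min (F s) (G s) = e i s := by
  obtain ⟨i, hi⟩ := hF
  obtain ⟨j, hj⟩ := hG
  rcases H i j with h | h
  · exact ⟨i, fun s hs => by rw [hi s hs, hj s hs, min_eq_left (h s hs)]⟩
  · exact ⟨j, fun s hs => by rw [hi s hs, hj s hs, min_eq_right (h s hs)]⟩

/-- The path which follows the valley line `slope * s + offset` as closely as the rectangle with
corners `x` and `y` permits. -/
noncomputable def valleyPath (slope offset : ℝ) (x y : ℝ × ℝ) (s : ℝ) : ℝ :=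
  max (max x.1 (s - y.2)) (min (min y.1 (s - x.2)) (slope * s + offset))

theorem isPath_valleyPath {slope : ℝ} (h0 : 0 ≤ slope) (h1 : slope ≤ 1) (offset : ℝ)
    {x y : ℝ × ℝ} (hxy : x ≤ y) : IsPath x y (valleyPath slope offset x y) := by
  have e1 := hxy.1
  have e2 := hxy.2
  refine IsPath.of_slow hxy ?_ ?_ fun a b _ _ hab => ⟨?_, ?_⟩
  · unfold valleyPath
    rw [max_eq_left (a := x.1) (by linarith), add_sub_cancel_right, min_eq_right e1]
    exact max_eq_left (min_le_left _ _)
  · unfold valleyPath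
    rw [add_sub_cancel_right, max_eq_right e1, min_eq_left (a := y.1) (by linarith)]
    exact max_eq_left (min_le_left _ _)
  · refine max_le_max (max_le_max le_rfl (by linarith)) (min_le_min (min_le_min le_rfl
      (by linarith)) ?_)
    nlinarith
  · unfold valleyPath
    have e3 : slope * b + offset ≤ slope * a + offset + (b - a) := by nlinarith
    rw [sub_le_iff_le_add]
    refine max_le (max_le ?_ ?_) ?_
    · linarith [(le_max_left x.1 (a - y.2)).trans (le_max_left _
        (min (min y.1 (a - x.2)) (slope * a + offset)))]
    · linarith [(le_max_right x.1 (a - y.2)).trans (le_max_left _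
        (min (min y.1 (a - x.2)) (slope * a + offset)))]
    · refine le_trans ?_ (add_le_add le_rfl (le_max_right _ _))
      rw [← min_add_add_left, ← min_add_add_left]
      refine min_le_min (min_le_min (by linarith) (by linarith)) (by linarith)

namespace ValleyCell

variable {J : Type*} {h : ℝ × ℝ → ℝ}

theorem valleyPath_le (c : ValleyCell J h) {x y : ℝ × ℝ} (hx : x ∈ Set.Icc c.lo c.up)
    (hy : y ∈ Set.Icc c.lo c.up) {f : ℝ → ℝ} (hf : IsPath x y f) {s : ℝ}
    (hs : s ∈ Set.Icc (x.1 + x.2) (y.1 + y.2)) :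
    h (valleyPath c.slope c.offset x y s, s - valleyPath c.slope c.offset x y s) ≤
      h (f s, s - f s) := by
  have hv := (isPath_valleyPath c.slope_nonneg c.slope_le_one c.offset hf.le).mem hs
  have hm := hf.mem hs
  refine c.valley s _ _ ⟨hx.1.trans hm.1, hm.2.trans hy.2⟩ ⟨hx.1.trans hv.1, hv.2.trans hy.2⟩ ?_
  have m1 : x.1 ≤ f s := hm.1.1
  have m2 : x.2 ≤ s - f s := hm.1.2
  have m3 : f s ≤ y.1 := hm.2.1
  have m4 : s - f s ≤ y.2 := hm.2.2
  have hlow : max x.1 (s - y.2) ≤ f s := max_le m1 (by linarith)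
  have hupp : f s ≤ min y.1 (s - x.2) := le_min m3 (by linarith)
  unfold valleyPath
  rcases le_total (c.slope * s + c.offset) (f s) with h | h
  · refine Or.inr ⟨?_, max_le hlow ((min_le_right _ _).trans h)⟩
    rw [min_eq_right (h.trans hupp)]
    exact le_max_right _ _
  · refine Or.inl ⟨?_, max_le (hlow.trans h) (min_le_right _ _)⟩
    exact (le_min hupp h).trans (le_max_right _ _)

/-- Within a cell every path can be replaced by a chain of bounded length. -/
theorem hasChain {κ : Type*} [Fintype J] [Nonempty J] (hc : Continuous h)
    (cell : κ → ValleyCell J h) (k : κ) {x y : ℝ × ℝ}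
    (hx : x ∈ Set.Icc (cell k).lo (cell k).up) (hy : y ∈ Set.Icc (cell k).lo (cell k).up)
    {f : ℝ → ℝ} (hf : IsPath x y f) :
    HasChain cell (2 ^ Fintype.card ((Fin 5 × Fin 5) ⊕ (Fin 5 × J × J))) x y
      (pathCost h x y f) := by
  set c := cell k with hck
  set F := valleyPath c.slope c.offset x y with hF
  have hFp : IsPath x y F := isPath_valleyPath c.slope_nonneg c.slope_le_one c.offset hf.le
  have hFcost : pathCost h x y F ≤ pathCost h x y f :=
    intervalIntegral.integral_mono_on hf.sum_le
      (hFp.intervalIntegrable hc le_rfl hf.sum_le le_rfl)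
      (hf.intervalIntegrable hc le_rfl hf.sum_le le_rfl) fun s hs => c.valleyPath_le hx hy hf hs
  refine HasChain.mono ?_ hFcost
  set p : Fin 5 → ℝ := ![0, 1, 0, 1, c.slope] with hp
  set q : Fin 5 → ℝ := ![x.1, -y.2, y.1, -x.2, c.offset] with hq
  set P : Fin 5 → J → ℝ := fun i r => c.A r * p i + c.B r * (1 - p i) with hP
  set Q : Fin 5 → J → ℝ := fun i r => (c.A r - c.B r) * q i + c.C r with hQ
  have hval : ∀ i r s, c.val r (p i * s + q i, s - (p i * s + q i)) = P i r * s + Q i r := by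
    intro i r s
    simp only [val, hP, hQ]
    ring
  have key := interval_induction
    (Sum.elim (fun ij : Fin 5 × Fin 5 => (q ij.2 - q ij.1) / (p ij.1 - p ij.2))
      (fun w : Fin 5 × J × J =>
        (Q w.1 w.2.2 - Q w.1 w.2.1) / (P w.1 w.2.1 - P w.1 w.2.2)))
    (fun n a b => x.1 + x.2 ≤ a → b ≤ y.1 + y.2 → HasChain cell n (F a, a - F a) (F b, b - F b)
      (∫ s in a..b, h (F s, s - F s))) ?_ ?_ _ _ hf.sum_le le_rfl le_rfl
  · rw [hFp.2.2.1, hFp.2.2.2.1, add_sub_cancel_left, add_sub_cancel_left] at key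
    exact key
  · intro a b hab hτ ha hb
    have cmp : ∀ i j, (∀ s ∈ Set.Icc a b, p i * s + q i ≤ p j * s + q j) ∨
        ∀ s ∈ Set.Icc a b, p j * s + q j ≤ p i * s + q i :=
      fun i j => affine_le_or_le (hτ (Sum.inl (i, j)))
    obtain ⟨i, hi⟩ : ∃ i, ∀ s ∈ Set.Icc a b, F s = p i * s + q i := by
      refine exists_eq_max cmp (exists_eq_max cmp ⟨0, ?_⟩ ⟨1, ?_⟩) (exists_eq_min cmp
        (exists_eq_min cmp ⟨2, ?_⟩ ⟨3, ?_⟩) ⟨4, ?_⟩)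
      all_goals
        intro s _
        simp [hp, hq]
      all_goals ring
    have hcmp : ∀ r r', (∀ s ∈ Set.Icc a b, P i r * s + Q i r ≤ P i r' * s + Q i r') ∨
        ∀ s ∈ Set.Icc a b, P i r' * s + Q i r' ≤ P i r * s + Q i r :=
      fun r r' => affine_le_or_le (hτ (Sum.inr (i, r, r')))
    obtain ⟨r, -, hr⟩ := Finset.exists_max_image Finset.univ
      (fun r => (P i r * a + Q i r) + (P i r * b + Q i r)) Finset.univ_nonempty
    have hmax : ∀ r', P i r' * a + Q i r' ≤ P i r * a + Q i r ∧
        P i r' * b + Q i r' ≤ P i r * b + Q i r := by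
      intro r'
      rcases hcmp r' r with h | h
      · exact ⟨h a ⟨le_rfl, hab⟩, h b ⟨hab, le_rfl⟩⟩
      · have h1 := h a ⟨le_rfl, hab⟩
        have h2 := h b ⟨hab, le_rfl⟩
        have h3 := hr r' (Finset.mem_univ _)
        constructor <;> linarith
    have hmem : ∀ s ∈ Set.Icc a b, (F s, s - F s) ∈ Set.Icc c.lo c.up := by
      intro s hs
      have := hFp.mem (s := s) ⟨ha.trans hs.1, hs.2.trans hb⟩
      exact ⟨hx.1.trans this.1, this.2.trans hy.2⟩
    have hvF : ∀ s ∈ Set.Icc a b, ∀ r, c.val r (F s, s - F s) = P i r * s + Q i r := by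
      intro s hs r
      rw [hi s hs, hval]
    have haa : a ∈ Set.Icc a b := ⟨le_rfl, hab⟩
    have hbb : b ∈ Set.Icc a b := ⟨hab, le_rfl⟩
    refine ⟨fun i => if i = 0 then (F a, a - F a) else (F b, b - F b), fun _ => (k, r),
      by simp, by simp, ?_, ?_⟩
    · intro j hj
      obtain rfl : j = 0 := by omega
      simp only [if_true, zero_add, one_ne_zero, if_false]
      refine ⟨(hFp.restrict ha hab hb).le, ⟨hmem a haa, fun r' => ?_⟩,
        ⟨hmem b hbb, fun r' => ?_⟩⟩
      · rw [← hck, hvF a haa, hvF a haa]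
        exact (hmax r').1
      · rw [← hck, hvF b hbb, hvF b hbb]
        exact (hmax r').2
    · simp only [chainCost, Finset.sum_range_one, if_true, zero_add, one_ne_zero, if_false]
      rw [← hck, stepCost, hvF a haa, hvF b hbb]
      simp only [add_sub_cancel]
      rw [← integral_affine]
      refine intervalIntegral.integral_mono_on hab
        ((by fun_prop : Continuous fun s => P i r * s + Q i r).intervalIntegrable _ _)
        (hFp.intervalIntegrable hc ha hab hb) fun s hs => ?_
      rw [← hvF s hs]
      exact c.affine_le _ (hmem s hs) r
  · intro n n' a b d hab hbd h1 h2 ha hd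
    rw [← intervalIntegral.integral_add_adjacent_intervals
      (hFp.intervalIntegrable hc ha hab (hbd.trans hd))
      (hFp.intervalIntegrable hc (ha.trans hab) hbd hd)]
    exact (h1 ha (hbd.trans hd)).trans (h2 (ha.trans hab) hd)

end ValleyCell

theorem exists_crossing_time {F : ℝ → ℝ} {a b : ℝ} (hm : MonotoneOn F (Set.Icc a b))
    (hF : ContinuousOn F (Set.Icc a b)) (c : ℝ) :
    ∃ τ, ∀ s ∈ Set.Icc a b, ∀ t ∈ Set.Icc a b, F s < c → c < F t → s < τ ∧ τ < t := by
  by_cases h : ∃ τ ∈ Set.Icc a b, F τ = c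
  · obtain ⟨τ, hτ, rfl⟩ := h
    exact ⟨τ, fun s hs t ht h1 h2 => ⟨hm.reflect_lt hs hτ h1, hm.reflect_lt hτ ht h2⟩⟩
  · refine ⟨0, fun s hs t ht h1 h2 => (h ?_).elim⟩
    have hst := hm.reflect_lt hs ht (h1.trans h2)
    have hsub : Set.Icc s t ⊆ Set.Icc a b := Set.Icc_subset_Icc hs.1 ht.2
    obtain ⟨τ, hτ, e⟩ := intermediate_value_Icc hst.le (hF.mono hsub) ⟨h1.le, h2.le⟩
    exact ⟨τ, hsub hτ, e⟩

/-- If a grid of lines cuts the box `[x, y]` into pieces covered by valley cells, then every path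
can be replaced by a chain of no greater cost, whose length depends only on the grid. -/
theorem hasChain_of_grid {κ J I₁ I₂ : Type*} [Fintype J] [Nonempty J] [Fintype I₁] [Fintype I₂]
    {h : ℝ × ℝ → ℝ} (hc : Continuous h) (cell : κ → ValleyCell J h) (T₁ : I₁ → ℝ) (T₂ : I₂ → ℝ)
    (c d : ℝ × ℝ)
    (hcover : ∀ x y, c ≤ x → x ≤ y → y ≤ d → (∀ i, ¬ (x.1 < T₁ i ∧ T₁ i < y.1)) →
      (∀ i, ¬ (x.2 < T₂ i ∧ T₂ i < y.2)) →
      ∃ k, x ∈ Set.Icc (cell k).lo (cell k).up ∧ y ∈ Set.Icc (cell k).lo (cell k).up) :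
    ∃ R, R ≠ 0 ∧ ∀ x y f, c ≤ x → y ≤ d → IsPath x y f →
      HasChain cell R x y (pathCost h x y f) := by
  set R₀ := 2 ^ Fintype.card ((Fin 5 × Fin 5) ⊕ (Fin 5 × J × J)) with hR₀
  refine ⟨2 ^ Fintype.card (I₁ ⊕ I₂) * R₀, by simp [hR₀], fun x y f hx hy hf => ?_⟩
  have hfc := hf.continuousOn
  choose τ₁ hτ₁ using fun i => exists_crossing_time hf.2.2.2.2.1 hfc (T₁ i)
  choose τ₂ hτ₂ using fun i => exists_crossing_time hf.2.2.2.2.2 (continuousOn_id.sub hfc) (T₂ i)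
  have key := interval_induction (Sum.elim τ₁ τ₂)
    (fun n a b => x.1 + x.2 ≤ a → b ≤ y.1 + y.2 → HasChain cell (n * R₀) (f a, a - f a)
      (f b, b - f b) (∫ s in a..b, h (f s, s - f s))) ?_ ?_ _ _ hf.sum_le le_rfl le_rfl
  · simp only [hf.2.2.1, hf.2.2.2.1, add_sub_cancel_left] at key
    exact key
  · intro a b hab hτ ha hb
    have hr := hf.restrict ha hab hb
    have ha' : a ∈ Set.Icc (x.1 + x.2) (y.1 + y.2) := ⟨ha, hab.trans hb⟩
    have hb' : b ∈ Set.Icc (x.1 + x.2) (y.1 + y.2) := ⟨ha.trans hab, hb⟩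
    obtain ⟨k, h1, h2⟩ := hcover _ _ (hx.trans (hf.mem ha').1) hr.le ((hf.mem hb').2.trans hy)
      (fun i hi => hτ (Sum.inl i) (hτ₁ i a ha' b hb' hi.1 hi.2))
      (fun i hi => hτ (Sum.inr i) (hτ₂ i a ha' b hb' hi.1 hi.2))
    have := ValleyCell.hasChain hc cell k h1 h2 hr
    rw [one_mul]
    simpa only [pathCost, add_sub_cancel] using this
  · intro n n' a b e hab hbe h1 h2 ha he
    have := (h1 ha (hbe.trans he)).trans (h2 (ha.trans hab) he)
    rw [intervalIntegral.integral_add_adjacent_intervals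
      (hf.intervalIntegrable hc ha hab (hbe.trans he))
      (hf.intervalIntegrable hc (ha.trans hab) hbe he), ← add_mul] at this
    exact this

section ChainSpace

variable {κ J : Type*} {h : ℝ × ℝ → ℝ}

/-- The affine function `A w.1 + B w.2` of the `i`-th vertex. -/
noncomputable def vertexForm (R : ℕ) (i : Fin R) (A B : ℝ) : (Fin R → ℝ × ℝ) →ₗ[ℝ] ℝ :=
  (A • LinearMap.fst ℝ ℝ ℝ + B • LinearMap.snd ℝ ℝ ℝ).comp (LinearMap.proj i)

@[simp]
theorem vertexForm_apply (R : ℕ) (i : Fin R) (A B : ℝ) (u : Fin R → ℝ × ℝ) :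
    vertexForm R i A B u = A * (u i).1 + B * (u i).2 := by
  simp [vertexForm]

theorem isPolyhedron_Icc (x y : ℝ × ℝ) : IsPolyhedron (Set.Icc x y) := by
  convert (((IsPolyhedron.halfspace (-LinearMap.fst ℝ ℝ ℝ) (-x.1)).inter
    (IsPolyhedron.halfspace (-LinearMap.snd ℝ ℝ ℝ) (-x.2))).inter
    ((IsPolyhedron.halfspace (LinearMap.fst ℝ ℝ ℝ) y.1).inter
    (IsPolyhedron.halfspace (LinearMap.snd ℝ ℝ ℝ) y.2))) using 1
  ext w
  simp [Prod.le_def]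

theorem ValleyCell.isPolyhedron_region [Finite J] (c : ValleyCell J h) (r : J) :
    IsPolyhedron (c.region r) := by
  convert (isPolyhedron_Icc c.lo c.up).inter (IsPolyhedron.iInter fun r' =>
    IsPolyhedron.halfspace ((c.A r' - c.A r) • LinearMap.fst ℝ ℝ ℝ +
      (c.B r' - c.B r) • LinearMap.snd ℝ ℝ ℝ) (c.C r - c.C r')) using 1
  ext w
  simp only [region, val, Set.mem_ofPred_eq, Set.mem_inter_iff, LinearMap.add_apply,
    LinearMap.smul_apply, LinearMap.fst_apply, LinearMap.snd_apply, smul_eq_mul]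
  refine and_congr_right fun _ => forall_congr' fun r' => ?_
  constructor <;> intro H <;> linarith

/-- The set of vertex sequences of chains with prescribed regions. -/
def chainSet (cell : κ → ValleyCell J h) (R : ℕ) (ρ : Fin R → κ × J) :
    Set (Fin (R + 1) → ℝ × ℝ) :=
  {u | ∀ i : Fin R, u i.castSucc ≤ u i.succ ∧ u i.castSucc ∈ (cell (ρ i).1).region (ρ i).2 ∧
    u i.succ ∈ (cell (ρ i).1).region (ρ i).2}

/-- The cost of a vertex sequence with prescribed regions. -/
noncomputable def chainSetCost (cell : κ → ValleyCell J h) (R : ℕ) (ρ : Fin R → κ × J)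
    (u : Fin (R + 1) → ℝ × ℝ) : ℝ :=
  ∑ i, (cell (ρ i).1).stepCost (ρ i).2 (u i.castSucc) (u i.succ)

theorem isPolyhedron_chainSet [Finite J] (cell : κ → ValleyCell J h) (R : ℕ) (ρ : Fin R → κ × J) :
    IsPolyhedron (chainSet cell R ρ) := by
  refine IsPolyhedron.iInter (K := fun i => {u : Fin (R + 1) → ℝ × ℝ | u i.castSucc ≤ u i.succ ∧
    u i.castSucc ∈ (cell (ρ i).1).region (ρ i).2 ∧
    u i.succ ∈ (cell (ρ i).1).region (ρ i).2}) fun i => ?_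
  have hP := (cell (ρ i).1).isPolyhedron_region (ρ i).2
  convert ((IsPolyhedron.halfspace
      (vertexForm (R + 1) i.castSucc 1 0 - vertexForm (R + 1) i.succ 1 0) 0).inter
    (IsPolyhedron.halfspace
      (vertexForm (R + 1) i.castSucc 0 1 - vertexForm (R + 1) i.succ 0 1) 0)).inter
    ((hP.preimage (LinearMap.proj i.castSucc)).inter (hP.preimage (LinearMap.proj i.succ))) using 1
  ext u
  simp [Prod.le_def]

theorem isQuadraticFn_chainSetCost (cell : κ → ValleyCell J h) (R : ℕ) (ρ : Fin R → κ × J) :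
    IsQuadraticFn (chainSetCost cell R ρ) := by
  refine IsQuadraticFn.sum _ fun i => ?_
  set c := cell (ρ i).1
  set r := (ρ i).2
  convert IsQuadraticFn.affine_mul_affine
    (vertexForm (R + 1) i.castSucc (c.A r / 2) (c.B r / 2) +
      vertexForm (R + 1) i.succ (c.A r / 2) (c.B r / 2))
    (vertexForm (R + 1) i.succ 1 1 - vertexForm (R + 1) i.castSucc 1 1) (c.C r) 0 using 2 with u
  simp only [ValleyCell.stepCost, ValleyCell.val, LinearMap.add_apply, LinearMap.sub_apply,
    vertexForm_apply]
  ring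

theorem exists_chain_of_mem_chainSet {cell : κ → ValleyCell J h} {R : ℕ} {ρ : Fin R → κ × J}
    {u : Fin (R + 1) → ℝ × ℝ} (hρ : R ≠ 0) (hu : u ∈ chainSet cell R ρ) :
    ∃ z ρ', z 0 = u 0 ∧ z R = u (Fin.last R) ∧ IsMonotoneChain cell R z ρ' ∧
      chainCost cell R z ρ' = chainSetCost cell R ρ u := by
  have hR : 0 < R := Nat.pos_of_ne_zero hρ
  refine ⟨fun i => if hi : i < R + 1 then u ⟨i, hi⟩ else 0,
    fun i => if hi : i < R then ρ ⟨i, hi⟩ else ρ ⟨0, hR⟩, ?_, ?_, ?_, ?_⟩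
  · simp
  · simp [Fin.last]
  · intro i hi
    have := hu ⟨i, hi⟩
    simpa [hi, Nat.lt_succ_of_lt hi] using this
  · rw [chainCost, chainSetCost, Finset.sum_range]
    refine Finset.sum_congr rfl fun i _ => ?_
    simp [Nat.lt_succ_of_lt i.2, Fin.castSucc, Fin.succ]
    rfl

theorem mem_chainSet_of_chain {cell : κ → ValleyCell J h} {R : ℕ} {z : ℕ → ℝ × ℝ}
    {ρ : ℕ → κ × J} (hz : IsMonotoneChain cell R z ρ) :
    (fun i : Fin (R + 1) => z i) ∈ chainSet cell R (fun i => ρ i) ∧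
      chainSetCost cell R (fun i => ρ i) (fun i => z i) = chainCost cell R z ρ := by
  refine ⟨fun i => hz i i.2, ?_⟩
  rw [chainCost, chainSetCost, Finset.sum_range]
  rfl

/-- The least cost of chains ending on a line is selected from finitely many quadratic
polynomials. -/
theorem exists_finite_quadratic_chainCost [Finite κ] [Finite J] (cell : κ → ValleyCell J h)
    {R : ℕ} (hR : R ≠ 0) (x b₀ b₁ : ℝ × ℝ) :
    ∃ S : Set (Polynomial ℝ), S.Finite ∧ (∀ f ∈ S, f.natDegree ≤ 2) ∧
      ∀ t : ℝ, (∃ c, HasChain cell R x (b₀ + t • b₁) c) → ∃ f ∈ S,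
        HasChain cell R x (b₀ + t • b₁) (f.eval t) ∧
        ∀ c, HasChain cell R x (b₀ + t • b₁) c → f.eval t ≤ c := by
  set D : (Fin (R + 1) → ℝ × ℝ) →ₗ[ℝ] (ℝ × ℝ) × (ℝ × ℝ) :=
    (LinearMap.proj 0).prod (LinearMap.proj (Fin.last R)) with hD
  have hDu : ∀ (u : Fin (R + 1) → ℝ × ℝ) (t : ℝ),
      D u = (x, b₀) + t • ((0, b₁) : (ℝ × ℝ) × (ℝ × ℝ)) ↔
      u 0 = x ∧ u (Fin.last R) = b₀ + t • b₁ := by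
    intro u t
    simp [hD, Prod.ext_iff]
  have hb : ∀ (ρ : Fin R → κ × J) (t : ℝ), Bornology.IsBounded
      {u | u ∈ chainSet cell R ρ ∧ D u = (x, b₀) + t • ((0, b₁) : (ℝ × ℝ) × (ℝ × ℝ))} := by
    intro ρ t
    refine (isCompact_Icc (a := fun _ : Fin (R + 1) => x)
      (b := fun _ => b₀ + t • b₁)).isBounded.subset ?_
    rintro u ⟨hu, h2⟩
    obtain ⟨e1, e2⟩ := (hDu u t).1 h2
    have hm : Monotone u := Fin.monotone_iff_le_succ.2 fun i => (hu i).1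
    exact ⟨fun i => e1 ▸ hm (Fin.zero_le i), fun i => e2 ▸ hm (Fin.le_last i)⟩
  choose S hSf hSd hS using fun ρ => exists_finite_quadratic_minimum
    (isPolyhedron_chainSet cell R ρ) D D.continuous_of_finiteDimensional (x, b₀) (0, b₁) (hb ρ)
    (isQuadraticFn_chainSetCost cell R ρ)
  refine ⟨⋃ ρ, S ρ, Set.finite_iUnion hSf, fun f hf => ?_, fun t ht => ?_⟩
  · obtain ⟨ρ, hρ⟩ := Set.mem_iUnion.1 hf
    exact hSd ρ f hρ
  set good : Set ℝ := {v | ∃ ρ, ∃ f ∈ S ρ, v = f.eval t ∧ ∃ u ∈ chainSet cell R ρ,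
    (u 0 = x ∧ u (Fin.last R) = b₀ + t • b₁) ∧ chainSetCost cell R ρ u = f.eval t} with hgood
  have hfin : good.Finite := by
    refine ((Set.finite_iUnion hSf).image fun f => f.eval t).subset ?_
    rintro v ⟨ρ, f, hf, rfl, -⟩
    exact ⟨f, Set.mem_iUnion.2 ⟨ρ, hf⟩, rfl⟩
  have hlow : ∀ c, HasChain cell R x (b₀ + t • b₁) c → ∃ v ∈ good, v ≤ c := by
    rintro c ⟨z, ρ, z0, zR, hz, hzc⟩
    obtain ⟨h1, h2⟩ := mem_chainSet_of_chain hz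
    have hend : D (fun i : Fin (R + 1) => z i) =
        (x, b₀) + t • ((0, b₁) : (ℝ × ℝ) × (ℝ × ℝ)) := (hDu _ t).2 ⟨z0, zR⟩
    obtain ⟨f, hf, u, hu, hDu', hq, hmin⟩ := hS (fun i : Fin R => ρ i) t ⟨_, h1, hend⟩
    exact ⟨_, ⟨_, f, hf, rfl, u, hu, (hDu _ t).1 hDu', hq⟩,
      hq.symm.le.trans ((hmin _ h1 hend).trans (h2.le.trans hzc))⟩
  obtain ⟨c, hc⟩ := ht
  obtain ⟨v, hv, -⟩ := hlow c hc
  obtain ⟨w, hw, hwmin⟩ := hfin.exists_minimal ⟨v, hv⟩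
  obtain ⟨ρ, f, hf, rfl, u, hu, ⟨u0, uR⟩, hcost⟩ := hw
  refine ⟨f, Set.mem_iUnion.2 ⟨ρ, hf⟩, ?_, fun c hc => ?_⟩
  · obtain ⟨z, ρ', z0, zR, hz, hzc⟩ := exists_chain_of_mem_chainSet hR hu
    exact ⟨z, ρ', z0.trans u0, zR.trans uR, hz, (hzc.trans hcost).le⟩
  · obtain ⟨v, hv, hvc⟩ := hlow c hc
    rcases le_total v (f.eval t) with h | h
    · exact (hwmin hv h).trans hvc
    · exact h.trans hvc

end ChainSpace

theorem continuousOn_optCost {h : ℝ × ℝ → ℝ} (hc : Continuous h) (h0 : ∀ z, 0 ≤ h z)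
    {x : ℝ × ℝ} {B : ℝ → ℝ × ℝ} {lo hi : ℝ} (hm : MonotoneOn B (Set.Icc lo hi))
    (hB : ContinuousOn B (Set.Icc lo hi)) (hx : ∀ t ∈ Set.Icc lo hi, x ≤ B t) :
    ContinuousOn (fun t => optCost h x (B t)) (Set.Icc lo hi) := by
  rcases lt_or_ge hi lo with hlt | hle
  · simp [Set.Icc_eq_empty_of_lt hlt]
  have hu : UniformContinuousOn B (Set.Icc lo hi) :=
    isCompact_Icc.uniformContinuousOn_of_continuous hB
  refine Metric.continuousOn_iff.2 fun t ht ε hε => ?_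
  obtain ⟨δ, hδ, H⟩ := optCost_uniform_continuity hc h0 x (B hi) hε
  obtain ⟨η, hη, Hη⟩ := Metric.continuousOn_iff.1 hB t ht δ hδ
  refine ⟨η, hη, fun s hs hst => ?_⟩
  have hd := Hη s hs hst
  rw [Prod.dist_eq, max_lt_iff, Real.dist_eq, Real.dist_eq, abs_lt, abs_lt] at hd
  rw [Real.dist_eq]
  rcases le_total s t with h | h
  · rw [abs_sub_comm]
    exact H _ _ (hx s hs) (hm hs ht h) (hm ht ⟨hle, le_rfl⟩ ht.2) (by linarith) (by linarith)
  · exact H _ _ (hx t ht) (hm ht hs h) (hm hs ⟨hle, le_rfl⟩ hs.2) (by linarith) (by linarith)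

/-- The optimum function of a monotone segment is piecewise quadratic if the parameter space is
covered by a grid of valley cells. -/
theorem piecewiseQuadraticOn_optCost_of_grid {κ J I₁ I₂ : Type*} [Finite κ] [Fintype J]
    [Nonempty J] [Fintype I₁] [Fintype I₂] {h : ℝ × ℝ → ℝ} (hc : Continuous h)
    (h0 : ∀ z, 0 ≤ h z) (cell : κ → ValleyCell J h) (T₁ : I₁ → ℝ) (T₂ : I₂ → ℝ) (c d : ℝ × ℝ)
    (hcover : ∀ x y, c ≤ x → x ≤ y → y ≤ d → (∀ i, ¬ (x.1 < T₁ i ∧ T₁ i < y.1)) →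
      (∀ i, ¬ (x.2 < T₂ i ∧ T₂ i < y.2)) →
      ∃ k, x ∈ Set.Icc (cell k).lo (cell k).up ∧ y ∈ Set.Icc (cell k).lo (cell k).up)
    {lo hi : ℝ} (hle : lo ≤ hi) (b₀ b₁ : ℝ × ℝ) (hb₁ : 0 ≤ b₁)
    (hB : ∀ t ∈ Set.Icc lo hi, b₀ + t • b₁ ∈ Set.Icc c d) :
    PiecewiseQuadraticOn (fun t => optCost h c (b₀ + t • b₁)) lo hi := by
  obtain ⟨R, hR, hchain⟩ := hasChain_of_grid hc cell T₁ T₂ c d hcover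
  obtain ⟨S, hSf, hSd, hS⟩ := exists_finite_quadratic_chainCost cell hR c b₀ b₁
  have : Fintype S := hSf.fintype
  refine piecewiseQuadraticOn_of_finite_selection (fun f : S => f.1) (fun f => hSd f f.2) hle ?_ ?_
  · refine continuousOn_optCost hc h0 (fun s _ t _ hst => ?_) (by fun_prop)
      fun t ht => (hB t ht).1
    exact add_le_add_right (smul_le_smul_of_nonneg_right hst hb₁) b₀
  · intro t ht
    have hle' := (hB t ht).1
    have hex : ∀ f, IsPath c (b₀ + t • b₁) f →
        HasChain cell R c (b₀ + t • b₁) (pathCost h c (b₀ + t • b₁) f) :=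
      fun f hf => hchain _ _ f le_rfl (hB t ht).2 hf
    obtain ⟨f₀, hf₀⟩ := exists_isPath hle'
    obtain ⟨f, hf, ⟨z, ρ, z0, zR, hz, hzc⟩, hmin⟩ := hS t ⟨_, hex f₀ hf₀⟩
    refine ⟨⟨f, hf⟩, le_antisymm ?_ (le_optCost hle' fun g hg => hmin _ (hex g hg))⟩
    have := (optCost_le_chainCost hc h0 hz).2.trans hzc
    rwa [z0, zR] at this

/-- The linear form of `y` that equals `1` on the edge of `R_k` between `v_r` and `v_{r+1}`. -/
noncomputable def edgeForm (k : ℕ) (r : ℤ) : (ℝ × ℝ) →ₗ[ℝ] ℝ :=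
  (Real.cos (theta k r + Real.pi / k) / Real.cos (Real.pi / k)) • LinearMap.fst ℝ ℝ ℝ +
    (Real.sin (theta k r + Real.pi / k) / Real.cos (Real.pi / k)) • LinearMap.snd ℝ ℝ ℝ

theorem edgeForm_apply (k : ℕ) (r : ℤ) (y : ℝ × ℝ) :
    edgeForm k r y = (y.1 * Real.cos (theta k r + Real.pi / k) +
      y.2 * Real.sin (theta k r + Real.pi / k)) / Real.cos (Real.pi / k) := by
  simp only [edgeForm, LinearMap.add_apply, LinearMap.smul_apply, LinearMap.fst_apply,
    LinearMap.snd_apply, smul_eq_mul]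
  ring

section Gauge

variable {k : ℕ}

theorem theta_add_mul (hk : 4 ≤ k) (r q : ℤ) :
    theta k (r + k * q) = theta k r + q * (2 * Real.pi) := by
  have : (k : ℝ) ≠ 0 := by positivity
  unfold theta
  push_cast
  field_simp

theorem vtx_mem_Rgon (hk : 4 ≤ k) (r : ℤ) : vtx k r ∈ Rgon k := by
  have hk0 : (k : ℤ) ≠ 0 := by omega
  have hkp : (0 : ℤ) < k := by omega
  have h1 := Int.emod_nonneg (r - 1) hk0
  have h2 := Int.emod_lt_of_pos (r - 1) hkp
  refine subset_convexHull ℝ _ ⟨(r - 1) % k + 1, by omega, by omega, ?_⟩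
  have hr : r = ((r - 1) % k + 1) + k * ((r - 1) / k) := by
    have := Int.emod_add_mul_ediv (r - 1) k
    omega
  conv_lhs => rw [hr]
  rw [vtx, theta_add_mul hk, Real.cos_add_int_mul_two_pi, Real.sin_add_int_mul_two_pi, vtx]

theorem edgeForm_emod (hk : 4 ≤ k) (r : ℤ) : edgeForm k (r % k) = edgeForm k r := by
  have hr : r = r % k + k * (r / k) := (Int.emod_add_mul_ediv r k).symm
  conv_rhs => rw [hr]
  rw [edgeForm, edgeForm, theta_add_mul hk, add_right_comm, Real.cos_add_int_mul_two_pi,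
    Real.sin_add_int_mul_two_pi]

theorem cos_pi_div_pos (hk : 4 ≤ k) : 0 < Real.cos (Real.pi / k) := by
  have hk4 : (4 : ℝ) ≤ k := by exact_mod_cast hk
  have hpi := Real.pi_pos
  refine Real.cos_pos_of_mem_Ioo ⟨by linarith [show 0 < Real.pi / k by positivity], ?_⟩
  exact div_lt_div_of_pos_left hpi two_pos (by linarith)

theorem cos_odd_mul_le (hk : 4 ≤ k) (o : ℤ) :
    Real.cos ((2 * o + 1) * (Real.pi / k)) ≤ Real.cos (Real.pi / k) := by
  have hk0 : (k : ℝ) ≠ 0 := by positivity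
  have hpi := Real.pi_pos
  have hd : 0 < Real.pi / k := by positivity
  have hkd : k * (Real.pi / k) = Real.pi := by field_simp
  have base : ∀ t : ℕ, 1 ≤ t → t ≤ k → Real.cos (t * (Real.pi / k)) ≤ Real.cos (Real.pi / k) := by
    intro t h1 h2
    have h1' : (1 : ℝ) ≤ t := by exact_mod_cast h1
    have h2' : (t : ℝ) ≤ k := by exact_mod_cast h2
    refine Real.cos_le_cos_of_nonneg_of_le_pi hd.le ?_ ?_
    · calc _ ≤ k * (Real.pi / k) := mul_le_mul_of_nonneg_right h2' hd.le
        _ = _ := hkd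
    · exact le_mul_of_one_le_left hd.le h1'
  have h1 := Int.emod_nonneg o (b := k) (by omega)
  have h2 := Int.emod_lt_of_pos o (b := k) (by omega)
  obtain ⟨t, ht⟩ := Int.eq_ofNat_of_zero_le h1
  have hr : o = t + k * (o / k) := by rw [← ht]; exact (Int.emod_add_mul_ediv o k).symm
  have ho : (2 * o + 1) * (Real.pi / k) =
      (2 * t + 1) * (Real.pi / k) + (o / k : ℤ) * (2 * Real.pi) := by
    have : (o : ℝ) = t + k * (o / k : ℤ) := by exact_mod_cast hr
    rw [this, ← hkd]
    field_simp
    ring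
  rw [ho, Real.cos_add_int_mul_two_pi]
  rcases le_or_gt (2 * t + 1) k with h | h
  · have := base (2 * t + 1) (by omega) h
    push_cast at this
    exact this
  · have := base (2 * k - (2 * t + 1)) (by omega) (by omega)
    rw [Nat.cast_sub (by omega)] at this
    push_cast at this
    rw [sub_mul, mul_assoc 2 (k : ℝ), hkd, Real.cos_two_pi_sub] at this
    exact this

theorem edgeForm_vtx_le (hk : 4 ≤ k) (r s : ℤ) : edgeForm k r (vtx k s) ≤ 1 := by
  rw [edgeForm_apply, div_le_one (cos_pi_div_pos hk)]
  simp only [vtx]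
  rw [← Real.cos_sub]
  refine le_of_eq_of_le ?_ (cos_odd_mul_le hk (r - s))
  rw [← Real.cos_neg]
  congr 1
  unfold theta
  push_cast
  ring

theorem edgeForm_le_one (hk : 4 ≤ k) (r : ℤ) {y : ℝ × ℝ} (hy : y ∈ Rgon k) :
    edgeForm k r y ≤ 1 := by
  have hc : Convex ℝ {y | edgeForm k r y ≤ 1} :=
    convex_halfSpace_le (edgeForm k r).isLinear 1
  refine convexHull_min ?_ hc hy
  rintro _ ⟨s, -, -, rfl⟩
  exact edgeForm_vtx_le hk r s

theorem edgeForm_vtx (hk : 4 ≤ k) (r : ℤ) : edgeForm k r (vtx k r) = 1 := by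
  rw [edgeForm_apply, div_eq_one_iff_eq (cos_pi_div_pos hk).ne']
  simp only [vtx]
  rw [← Real.cos_sub, ← Real.cos_neg]
  congr 1
  ring

theorem edgeForm_vtx_succ (hk : 4 ≤ k) (r : ℤ) : edgeForm k r (vtx k (r + 1)) = 1 := by
  rw [edgeForm_apply, div_eq_one_iff_eq (cos_pi_div_pos hk).ne']
  simp only [vtx]
  rw [← Real.cos_sub]
  congr 1
  unfold theta
  push_cast
  ring

theorem edgeForm_add_half (hk : 4 ≤ k) (hke : Even k) (r : ℤ) (y : ℝ × ℝ) :
    edgeForm k (r + k / 2) y = edgeForm k r (-y) := by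
  obtain ⟨l, rfl⟩ := hke
  have hl : (l : ℝ) ≠ 0 := by
    have : l ≠ 0 := by omega
    exact_mod_cast this
  have : theta (l + l) (r + ((l + l : ℕ) : ℤ) / 2) = theta (l + l) r + Real.pi := by
    have : ((l + l : ℕ) : ℤ) / 2 = l := by omega
    rw [this]
    unfold theta
    push_cast
    field_simp
    ring
  rw [edgeForm_apply, edgeForm_apply, this, add_right_comm, Real.cos_add_pi, Real.sin_add_pi]
  simp only [Prod.fst_neg, Prod.snd_neg]
  ring

theorem exists_mem_edgeForm_smul (hk : 4 ≤ k) (y : ℝ × ℝ) :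
    ∃ r : ℤ, 0 ≤ edgeForm k r y ∧ y ∈ edgeForm k r y • Rgon k := by
  set w : ℂ := ⟨y.1, y.2⟩
  set φ := w.arg
  have hpi := Real.pi_pos
  have hk4 : (4 : ℝ) ≤ k := by exact_mod_cast hk
  have hd : 0 < 2 * Real.pi / k := by positivity
  have hd' : 2 * Real.pi / k < Real.pi := by
    rw [div_lt_iff₀ (by linarith)]
    nlinarith
  have hθ : ∀ r : ℤ, theta k r = r * (2 * Real.pi / k) := fun r => by unfold theta; ring
  set r := ⌊φ / (2 * Real.pi / k)⌋ with hr
  have h1 : theta k r ≤ φ := by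
    rw [hθ]
    exact (le_div_iff₀ hd).1 (Int.floor_le _)
  have h2 : φ ≤ theta k (r + 1) := by
    rw [hθ]
    push_cast
    exact ((div_lt_iff₀ hd).1 (Int.lt_floor_add_one _)).le
  have h3 : theta k (r + 1) = theta k r + 2 * Real.pi / k := by
    rw [hθ, hθ]
    push_cast
    ring
  set S := Real.sin (theta k (r + 1) - theta k r) with hS
  have hSpos : 0 < S := Real.sin_pos_of_pos_of_lt_pi (by linarith) (by linarith)
  set a := ‖w‖ * Real.sin (theta k (r + 1) - φ) / S with ha
  set b := ‖w‖ * Real.sin (φ - theta k r) / S with hb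
  have ha0 : 0 ≤ a := div_nonneg (mul_nonneg (norm_nonneg _)
    (Real.sin_nonneg_of_nonneg_of_le_pi (by linarith) (by linarith))) hSpos.le
  have hb0 : 0 ≤ b := div_nonneg (mul_nonneg (norm_nonneg _)
    (Real.sin_nonneg_of_nonneg_of_le_pi (by linarith) (by linarith))) hSpos.le
  have hy1 : ‖w‖ * Real.cos φ = y.1 := Complex.norm_mul_cos_arg w
  have hy2 : ‖w‖ * Real.sin φ = y.2 := Complex.norm_mul_sin_arg w
  have hy : y = a • vtx k r + b • vtx k (r + 1) := by
    ext
    · simp only [Prod.fst_add, Prod.smul_fst, vtx, smul_eq_mul, ha, hb, ← hy1]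
      field_simp
      rw [hS, Real.sin_sub, Real.sin_sub, Real.sin_sub]
      ring
    · simp only [Prod.snd_add, Prod.smul_snd, vtx, smul_eq_mul, ha, hb, ← hy2]
      field_simp
      rw [hS, Real.sin_sub, Real.sin_sub, Real.sin_sub]
      ring
  have hab : edgeForm k r y = a + b := by
    rw [hy, map_add, map_smul, map_smul, edgeForm_vtx hk, edgeForm_vtx_succ hk]
    simp
  refine ⟨r, by rw [hab]; positivity, ?_⟩
  rw [hab, (show Convex ℝ (Rgon k) from convex_convexHull ℝ _).add_smul ha0 hb0, hy]
  exact Set.add_mem_add (Set.smul_mem_smul_set (vtx_mem_Rgon hk r))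
    (Set.smul_mem_smul_set (vtx_mem_Rgon hk _))

theorem edgeForm_le_gaugeFn (hk : 4 ≤ k) (r : ℤ) (y : ℝ × ℝ) :
    edgeForm k r y ≤ gaugeFn (Rgon k) y := by
  obtain ⟨r', h0, hr'⟩ := exists_mem_edgeForm_smul hk y
  refine le_csInf ⟨_, h0, hr'⟩ ?_
  rintro l ⟨hl, x, hx, rfl⟩
  simpa using mul_le_mul_of_nonneg_left (edgeForm_le_one hk r hx) hl

theorem exists_gaugeFn_eq_edgeForm (hk : 4 ≤ k) (y : ℝ × ℝ) :
    ∃ r, gaugeFn (Rgon k) y = edgeForm k r y ∧ y ∈ gaugeFn (Rgon k) y • Rgon k := by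
  obtain ⟨r, h0, hr⟩ := exists_mem_edgeForm_smul hk y
  have : gaugeFn (Rgon k) y = edgeForm k r y :=
    le_antisymm (csInf_le ⟨0, fun l hl => hl.1⟩ ⟨h0, hr⟩) (edgeForm_le_gaugeFn hk r y)
  exact ⟨r, this, this ▸ hr⟩

theorem gaugeFn_image (K : Set (ℝ × ℝ)) (e : (ℝ × ℝ) ≃ₗ[ℝ] (ℝ × ℝ)) (z : ℝ × ℝ) :
    gaugeFn (e '' K) z = gaugeFn K (e.symm z) := by
  unfold gaugeFn
  congr 1
  ext l
  refine and_congr_right fun _ => ?_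
  constructor
  · rintro ⟨_, ⟨x, hx, rfl⟩, rfl⟩
    exact ⟨x, hx, by simp⟩
  · rintro ⟨x, hx, h⟩
    exact ⟨e x, ⟨x, hx, rfl⟩, by simpa [← map_smul] using congrArg e h⟩

end Gauge

/-- A norm on the plane that is a maximum of finitely many linear forms. -/
structure IsPolyhedralNorm {J : Type*} (N : ℝ × ℝ → ℝ) (Φ : J → (ℝ × ℝ) →ₗ[ℝ] ℝ) : Prop where
  form_le : ∀ j z, Φ j z ≤ N z
  attained : ∀ z, ∃ j, N z = Φ j z
  neg : ∀ z, N (-z) = N z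
  eq_zero : ∀ z, N z = 0 → z = 0

theorem exists_isPolyhedralNorm {k : ℕ} (hk : 4 ≤ k) (hke : Even k)
    {ψ : (ℝ × ℝ) →ₗ[ℝ] (ℝ × ℝ)} (hψ : Function.Bijective ψ)
    {N : ℝ × ℝ → ℝ} (hN : ∀ z : ℝ × ℝ, N z = gaugeFn (ψ '' Rgon k) z) :
    ∃ Φ : Fin k → (ℝ × ℝ) →ₗ[ℝ] ℝ, IsPolyhedralNorm N Φ := by
  set e := LinearEquiv.ofBijective ψ hψ with he
  have hN' : ∀ z, N z = gaugeFn (Rgon k) (e.symm z) := fun z => by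
    rw [hN, ← gaugeFn_image]
    rfl
  have hneg : ∀ z, N (-z) ≤ N z := by
    intro z
    obtain ⟨r, hr, -⟩ := exists_gaugeFn_eq_edgeForm hk (e.symm (-z))
    rw [hN', hr, map_neg, ← edgeForm_add_half hk hke, hN']
    exact edgeForm_le_gaugeFn hk _ _
  refine ⟨fun j => (edgeForm k j).comp e.symm.toLinearMap, ⟨fun j z => ?_, fun z => ?_,
    fun z => le_antisymm (hneg z) (by simpa using hneg (-z)), fun z hz => ?_⟩⟩
  · rw [hN']
    exact edgeForm_le_gaugeFn hk _ _
  · obtain ⟨r, hr, -⟩ := exists_gaugeFn_eq_edgeForm hk (e.symm z)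
    have h1 := Int.emod_nonneg r (b := k) (by omega)
    have h2 := Int.emod_lt_of_pos r (b := k) (by omega)
    refine ⟨⟨(r % k).toNat, by omega⟩, ?_⟩
    rw [hN', hr, ← edgeForm_emod hk]
    simp [h1]
  · obtain ⟨r, -, hr⟩ := exists_gaugeFn_eq_edgeForm hk (e.symm z)
    rw [← hN', hz] at hr
    have := Set.zero_smul_set_subset _ hr
    simpa using this

namespace IsPolyhedralNorm

variable {J : Type*} {N : ℝ × ℝ → ℝ} {Φ : J → (ℝ × ℝ) →ₗ[ℝ] ℝ}

theorem zero (hN : IsPolyhedralNorm N Φ) : N 0 = 0 := by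
  obtain ⟨j, hj⟩ := hN.attained 0
  rw [hj, map_zero]

theorem nonneg (hN : IsPolyhedralNorm N Φ) (z : ℝ × ℝ) : 0 ≤ N z := by
  obtain ⟨j, -⟩ := hN.attained 0
  have h1 := hN.form_le j z
  have h2 := hN.form_le j (-z)
  rw [hN.neg, map_neg] at h2
  linarith

theorem add_le (hN : IsPolyhedralNorm N Φ) (x y : ℝ × ℝ) : N (x + y) ≤ N x + N y := by
  obtain ⟨j, hj⟩ := hN.attained (x + y)
  rw [hj, map_add]
  exact add_le_add (hN.form_le j x) (hN.form_le j y)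

theorem smul_of_nonneg (hN : IsPolyhedralNorm N Φ) {t : ℝ} (ht : 0 ≤ t) (z : ℝ × ℝ) :
    N (t • z) = t * N z := by
  refine le_antisymm ?_ ?_
  · obtain ⟨j, hj⟩ := hN.attained (t • z)
    rw [hj, map_smul]
    exact mul_le_mul_of_nonneg_left (hN.form_le j z) ht
  · obtain ⟨j, hj⟩ := hN.attained z
    rw [hj]
    simpa using hN.form_le j (t • z)

theorem smul (hN : IsPolyhedralNorm N Φ) (t : ℝ) (z : ℝ × ℝ) : N (t • z) = |t| * N z := by
  rcases le_total 0 t with h | h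
  · rw [hN.smul_of_nonneg h, abs_of_nonneg h]
  · rw [← hN.neg, ← neg_smul, hN.smul_of_nonneg (neg_nonneg.2 h), abs_of_nonpos h]

theorem continuous [Finite J] (hN : IsPolyhedralNorm N Φ) : Continuous N := by
  have := Fintype.ofFinite J
  obtain ⟨j, -⟩ := hN.attained 0
  have hne : (Finset.univ : Finset J).Nonempty := ⟨j, Finset.mem_univ j⟩
  have : N = fun z => Finset.univ.sup' hne fun j => Φ j z := by
    ext z
    refine le_antisymm ?_ (Finset.sup'_le _ _ fun j _ => hN.form_le j z)
    obtain ⟨j, hj⟩ := hN.attained z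
    rw [hj]
    exact Finset.le_sup' (fun j => Φ j z) (Finset.mem_univ j)
  rw [this]
  exact Continuous.finset_sup'_apply hne fun j _ => (Φ j).continuous_of_finiteDimensional

/-- Along a line, a norm decreases towards a minimizer. -/
theorem le_of_between (hN : IsPolyhedralNorm N Φ) {c w : ℝ × ℝ} {μ : ℝ}
    (hμ : ∀ x : ℝ, N (c + μ • w) ≤ N (c + x • w)) {a b : ℝ}
    (hab : a ≤ b ∧ b ≤ μ ∨ μ ≤ b ∧ b ≤ a) : N (c + b • w) ≤ N (c + a • w) := by
  obtain ⟨t, ht, rfl⟩ : ∃ t ∈ Set.Icc (0 : ℝ) 1, b = a + t * (μ - a) := by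
    by_cases h : a = μ
    · exact ⟨0, ⟨le_rfl, zero_le_one⟩, by rcases hab with h' | h' <;> linarith [h'.1, h'.2]⟩
    · have h' : μ - a ≠ 0 := sub_ne_zero.2 (Ne.symm h)
      refine ⟨(b - a) / (μ - a), ?_, by field_simp; ring⟩
      rcases hab with ⟨h1, h2⟩ | ⟨h1, h2⟩
      · have : 0 < μ - a := lt_of_le_of_ne (by linarith) h'.symm
        exact ⟨div_nonneg (by linarith) this.le, (div_le_one this).2 (by linarith)⟩
      · have : μ - a < 0 := lt_of_le_of_ne (by linarith) h'
        exact ⟨div_nonneg_of_nonpos (by linarith) this.le, (div_le_one_of_neg this).2 (by linarith)⟩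
  have e : c + (a + t * (μ - a)) • w = (1 - t) • (c + a • w) + t • (c + μ • w) := by module
  have h1 := hN.add_le ((1 - t) • (c + a • w)) (t • (c + μ • w))
  rw [hN.smul_of_nonneg (by linarith [ht.2]), hN.smul_of_nonneg ht.1] at h1
  rw [e]
  nlinarith [hμ a, ht.1]

/-- On every line with direction of norm one there is a point closest to the origin. -/
theorem exists_min_line [Finite J] (hN : IsPolyhedralNorm N Φ) {u : ℝ × ℝ} (hu : N u = 1)
    (c : ℝ × ℝ) : ∃ y : ℝ, ∀ x : ℝ, N (c + y • u) ≤ N (c + x • u) := by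
  have hc := hN.nonneg c
  obtain ⟨y, hy, hmin⟩ := isCompact_Icc.exists_isMinOn
    (Set.nonempty_Icc.2 (show -(2 * N c) ≤ 2 * N c by linarith))
    (hN.continuous.comp (by fun_prop : Continuous fun x : ℝ => c + x • u)).continuousOn
  refine ⟨y, fun x => ?_⟩
  by_cases hx : x ∈ Set.Icc (-(2 * N c)) (2 * N c)
  · exact hmin hx
  · have h0 : N (c + y • u) ≤ N (c + (0 : ℝ) • u) := hmin ⟨by linarith, by linarith⟩
    have h1 := hN.add_le (c + x • u) (-c)
    rw [add_neg_cancel_comm, hN.smul, hu, hN.neg, mul_one] at h1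
    have h2 : 2 * N c < |x| := by
      rw [Set.mem_Icc, ← abs_le] at hx
      exact not_le.1 hx
    rw [zero_smul, add_zero] at h0
    linarith

/-- For two independent directions of norm one, the minimizers lie on a monotone line. -/
theorem exists_slope [Finite J] (hN : IsPolyhedralNorm N Φ) {u v : ℝ × ℝ} (hu : N u = 1)
    (hv : N v = 1) : ∃ α ∈ Set.Icc (0 : ℝ) 1, ∀ s x : ℝ,
      N ((α * s) • (u + v) - s • v) ≤ N (x • (u + v) - s • v) := by
  obtain ⟨α, hα, hmin⟩ := isCompact_Icc.exists_isMinOn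
    (Set.nonempty_Icc.2 (zero_le_one (α := ℝ)))
    (hN.continuous.comp (by fun_prop : Continuous fun x : ℝ => x • (u + v) - v)).continuousOn
  have h0 : N (α • (u + v) - v) ≤ 1 := by
    have : N (α • (u + v) - v) ≤ N ((0 : ℝ) • (u + v) - v) := hmin ⟨le_rfl, zero_le_one⟩
    rwa [zero_smul, zero_sub, hN.neg, hv] at this
  have hglob : ∀ x : ℝ, N (α • (u + v) - v) ≤ N (x • (u + v) - v) := by
    intro x
    by_cases hx0 : x < 0
    · have h1 := hN.add_le (x • (u + v) - v) ((-x) • u)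
      rw [show x • (u + v) - v + (-x) • u = (-(1 - x)) • v by module, hN.smul, hN.smul, hu, hv,
        abs_neg, abs_of_nonneg (by linarith), abs_of_nonneg (by linarith)] at h1
      linarith
    by_cases hx1 : 1 < x
    · have h1 := hN.add_le (x • (u + v) - v) ((-(x - 1)) • v)
      rw [show x • (u + v) - v + (-(x - 1)) • v = x • u by module, hN.smul, hN.smul, hu, hv,
        abs_neg, abs_of_nonneg (by linarith), abs_of_nonneg (by linarith)] at h1
      linarith
    exact hmin ⟨by linarith, by linarith⟩
  refine ⟨α, hα, fun s x => ?_⟩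
  rcases eq_or_ne s 0 with rfl | hs
  · simpa [hN.zero] using hN.nonneg _
  · rw [show (α * s) • (u + v) - s • v = s • (α • (u + v) - v) by module,
      show x • (u + v) - s • v = s • ((x / s) • (u + v) - v) by
        rw [smul_sub, smul_smul, mul_div_cancel₀ _ hs], hN.smul, hN.smul]
    exact mul_le_mul_of_nonneg_left (hglob _) (abs_nonneg s)

theorem exists_valley [Finite J] (hN : IsPolyhedralNorm N Φ) {u v : ℝ × ℝ} (hu : N u = 1)
    (hv : N v = 1) (c : ℝ × ℝ) : ∃ α ∈ Set.Icc (0 : ℝ) 1, ∃ β : ℝ, ∀ s x : ℝ,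
      N (c - s • v + (α * s + β) • (u + v)) ≤ N (c - s • v + x • (u + v)) := by
  by_cases hd : u.1 * v.2 - u.2 * v.1 = 0
  · obtain ⟨t, rfl⟩ : ∃ t : ℝ, v = t • u := by
      have hu0 : u ≠ 0 := by
        rintro rfl
        rw [hN.zero] at hu
        exact zero_ne_one hu
      by_cases h1 : u.1 = 0
      · have h2 : u.2 ≠ 0 := fun h2 => hu0 (Prod.ext h1 h2)
        have h3 : v.1 = 0 := by
          rw [h1] at hd
          simpa [h2] using hd
        exact ⟨v.2 / u.2, Prod.ext (by simp [h1, h3]) (by simp [h2])⟩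
      · refine ⟨v.1 / u.1, Prod.ext (by simp [h1]) ?_⟩
        simp only [Prod.smul_snd, smul_eq_mul]
        field_simp
        linarith
    rw [hN.smul, hu, mul_one] at hv
    rcases (abs_eq zero_le_one).1 hv with rfl | rfl
    · obtain ⟨y, hy⟩ := hN.exists_min_line hu c
      refine ⟨1 / 2, by norm_num, y / 2, fun s x => ?_⟩
      convert hy (2 * x - s) using 2 <;> module
    · refine ⟨0, by norm_num, 0, fun s x => le_of_eq ?_⟩
      congr 1
      module
  · obtain ⟨α, hα, H⟩ := hN.exists_slope hu hv
    set d := u.1 * v.2 - u.2 * v.1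
    set c₁ := (c.1 * v.2 - c.2 * v.1) / d with hc₁
    set c₂ := ((u + v).1 * c.2 - (u + v).2 * c.1) / d with hc₂
    have hc : c = c₁ • (u + v) + c₂ • v := by
      ext
      · simp only [Prod.fst_add, Prod.smul_fst, smul_eq_mul, hc₁, hc₂, Prod.snd_add]
        field_simp
        ring
      · simp only [Prod.fst_add, Prod.smul_snd, smul_eq_mul, hc₁, hc₂, Prod.snd_add]
        field_simp
        ring
    refine ⟨α, hα, -(α * c₂) - c₁, fun s x => ?_⟩
    convert H (s - c₂) (x + c₁) using 2
    · rw [hc]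
      module
    · rw [hc]
      module

/-- The distance of two affine motions of unit speed, given on a rectangle, is a valley cell. -/
theorem exists_valleyCell [Finite J] (hN : IsPolyhedralNorm N Φ) {u v : ℝ × ℝ} (hu : N u = 1)
    (hv : N v = 1) (c lo up : ℝ × ℝ) {h : ℝ × ℝ → ℝ}
    (hh : ∀ w ∈ Set.Icc lo up, h w = N (c + w.1 • u - w.2 • v)) :
    ∃ C : ValleyCell J h, C.lo = lo ∧ C.up = up := by
  obtain ⟨α, hα, β, H⟩ := hN.exists_valley hu hv c
  have e : ∀ (w : ℝ × ℝ) j, Φ j (c + w.1 • u - w.2 • v) = Φ j u * w.1 + -Φ j v * w.2 + Φ j c := by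
    intro w j
    simp only [map_add, map_sub, map_smul, smul_eq_mul]
    ring
  refine ⟨⟨lo, up, fun j => Φ j u, fun j => -Φ j v, fun j => Φ j c, α, β, fun w hw j => ?_,
    fun w hw => ?_, hα.1, hα.2, fun s a b ha hb hab => ?_⟩, rfl, rfl⟩
  · rw [← e, hh w hw]
    exact hN.form_le j _
  · obtain ⟨j, hj⟩ := hN.attained (c + w.1 • u - w.2 • v)
    exact ⟨j, by rw [hh w hw, hj, e]⟩
  · rw [hh _ ha, hh _ hb]
    convert hN.le_of_between (H s) hab using 2 <;> simp only <;> module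

theorem exists_unit (hN : IsPolyhedralNorm N Φ) : ∃ u, N u = 1 := by
  have h1 : N (1, 0) ≠ 0 := fun h => by simpa using hN.eq_zero _ h
  refine ⟨(N (1, 0))⁻¹ • (1, 0), ?_⟩
  rw [hN.smul_of_nonneg (inv_nonneg.2 (hN.nonneg _)), inv_mul_cancel₀ h1]

end IsPolyhedralNorm

section Curve

variable {J : Type*} {N : ℝ × ℝ → ℝ} {Φ : J → (ℝ × ℝ) →ₗ[ℝ] ℝ} {n : ℕ} {p : ℕ → ℝ × ℝ}
  {L : ℕ → ℝ} {P : ℝ → ℝ × ℝ}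

theorem IsUnitSpeedParam.zero (hP : IsUnitSpeedParam N n p L P) : L 0 = 0 := by
  rw [hP.2.1]
  simp

theorem IsUnitSpeedParam.monotone (hN : IsPolyhedralNorm N Φ) (hP : IsUnitSpeedParam N n p L P) :
    Monotone L := by
  refine monotone_nat_of_le_succ fun i => ?_
  rw [hP.2.1, hP.2.1, Finset.sum_Icc_succ_top (by omega)]
  exact le_add_of_nonneg_right (hN.nonneg _)

/-- A unit-speed polygonal curve moves with a constant velocity of norm one on each edge. -/
theorem IsUnitSpeedParam.exists_velocity (hN : IsPolyhedralNorm N Φ)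
    (hP : IsUnitSpeedParam N n p L P) {i : ℕ} (hi : i ≤ n) :
    ∃ c u, N u = 1 ∧ ∀ s ∈ Set.Icc (L (i - 1)) (L i), P s = c + s • u := by
  rcases Nat.eq_zero_or_pos i with rfl | hpos
  · obtain ⟨u, hu⟩ := hN.exists_unit
    refine ⟨P (L 0) - L 0 • u, u, hu, fun s hs => ?_⟩
    obtain rfl : s = L 0 := le_antisymm hs.2 hs.1
    simp
  · set d := p i - p (i - 1) with hd
    have hd0 : N d ≠ 0 := fun h => hP.1 i hpos hi (sub_eq_zero.1 (hN.eq_zero d h))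
    refine ⟨p (i - 1) - (L (i - 1) / N d) • d, (N d)⁻¹ • d, ?_, fun s hs => ?_⟩
    · rw [hN.smul_of_nonneg (inv_nonneg.2 (hN.nonneg _)), inv_mul_cancel₀ hd0]
    · rw [hP.2.2 i hpos hi s hs, ← hd]
      module

theorem IsUnitSpeedParam.continuousOn (hN : IsPolyhedralNorm N Φ)
    (hP : IsUnitSpeedParam N n p L P) {i : ℕ} (hi : i ≤ n) :
    ContinuousOn P (Set.Icc 0 (L i)) := by
  have hm := hP.monotone hN
  induction i with
  | zero =>
    rw [hP.zero, Set.Icc_self]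
    exact continuousOn_singleton _ _
  | succ i ih =>
    have h0 : 0 ≤ L i := hP.zero ▸ hm (Nat.zero_le i)
    rw [← Set.Icc_union_Icc_eq_Icc h0 (hm i.le_succ)]
    refine (ih (by omega)).union_of_isClosed ?_ isClosed_Icc isClosed_Icc
    obtain ⟨c, u, -, hu⟩ := hP.exists_velocity hN hi
    exact ContinuousOn.congr (by fun_prop) hu

/-- A unit-speed polygonal curve extends to a continuous map on the line. -/
theorem IsUnitSpeedParam.exists_extension (hN : IsPolyhedralNorm N Φ)
    (hP : IsUnitSpeedParam N n p L P) :
    ∃ P' : ℝ → ℝ × ℝ, Continuous P' ∧ ∀ s ∈ Set.Icc 0 (L n), P' s = P s := by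
  have h0 : 0 ≤ L n := hP.zero ▸ hP.monotone hN (Nat.zero_le n)
  refine ⟨fun s => P (max 0 (min s (L n))), (hP.continuousOn hN le_rfl).comp_continuous
    (by fun_prop) fun s => ⟨le_max_left _ _, max_le h0 (min_le_right _ _)⟩, fun s hs => ?_⟩
  simp [hs.1, hs.2]

theorem exists_grid_interval (hL : L 0 = 0) {a b : ℝ} (ha : 0 ≤ a) (hb : b ≤ L n)
    (h : ∀ i : Fin (n + 1), ¬ (a < L i ∧ L i < b)) :
    ∃ i : Fin (n + 1), L (i - 1) ≤ a ∧ b ≤ L i := by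
  classical
  have hex : ∃ i, b ≤ L i := ⟨n, hb⟩
  have hi : Nat.find hex ≤ n := Nat.find_min' hex hb
  refine ⟨⟨Nat.find hex, by omega⟩, ?_, Nat.find_spec hex⟩
  simp only
  rcases Nat.eq_zero_or_pos (Nat.find hex) with h0 | hpos
  · rw [h0, hL]
    exact ha
  · have h1 := Nat.find_min hex (m := Nat.find hex - 1) (by omega)
    by_contra! h2
    exact h ⟨Nat.find hex - 1, by omega⟩ ⟨h2, not_le.1 h1⟩

end Curve

theorem PiecewiseQuadraticOn.congr {F G : ℝ → ℝ} {lo hi : ℝ} (hF : PiecewiseQuadraticOn F lo hi)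
    (hFG : ∀ t ∈ Set.Icc lo hi, F t = G t) : PiecewiseQuadraticOn G lo hi := by
  obtain ⟨m, a, rfl, rfl, hmono, hq⟩ := hF
  have h1 : ∀ j ≤ m, a 0 ≤ a j := by
    intro j hj
    induction j with
    | zero => exact le_rfl
    | succ j ih => exact (ih (by omega)).trans (hmono j (by omega))
  have h2 : ∀ i j, j + i = m → a j ≤ a m := by
    intro i
    induction i with
    | zero => exact fun j hj => (congrArg a hj).le
    | succ i ih => exact fun j hj => (hmono j (by omega)).trans (ih (j + 1) (by omega))
  refine ⟨m, a, rfl, rfl, hmono, fun j hj => ?_⟩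
  obtain ⟨c0, c1, c2, H⟩ := hq j hj
  refine ⟨c0, c1, c2, fun t ht => ?_⟩
  rw [← H t ht, hFG t ⟨(h1 j hj.le).trans ht.1, ht.2.trans (h2 (m - (j + 1)) (j + 1) (by omega))⟩]

/-- Under a polyhedral norm the optimum function on a monotone line in the parameter space of two
unit-speed polygonal curves is piecewise quadratic. -/
theorem piecewiseQuadraticOn_optCost_of_isUnitSpeedParam {J : Type*} [Fintype J] [Nonempty J]
    {N : ℝ × ℝ → ℝ} {Φ : J → (ℝ × ℝ) →ₗ[ℝ] ℝ} (hN : IsPolyhedralNorm N Φ)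
    {n m : ℕ} {p q : ℕ → ℝ × ℝ} {L M : ℕ → ℝ} {P Q : ℝ → ℝ × ℝ}
    (hP : IsUnitSpeedParam N n p L P) (hQ : IsUnitSpeedParam N m q M Q)
    {lo hi : ℝ} (hle : lo ≤ hi) (b₀ b₁ : ℝ × ℝ) (hb₁ : 0 ≤ b₁)
    (hB : ∀ t ∈ Set.Icc lo hi, b₀ + t • b₁ ∈ Set.Icc ((0 : ℝ), (0 : ℝ)) (L n, M m)) :
    PiecewiseQuadraticOn
      (fun t => optCost (fun z => N (P z.1 - Q z.2)) ((0 : ℝ), (0 : ℝ)) (b₀ + t • b₁)) lo hi := by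
  have hLm := hP.monotone hN
  have hMm := hQ.monotone hN
  obtain ⟨P', hP'c, hP'⟩ := hP.exists_extension hN
  obtain ⟨Q', hQ'c, hQ'⟩ := hQ.exists_extension hN
  set h' : ℝ × ℝ → ℝ := fun z => N (P' z.1 - Q' z.2) with hh'
  have hc : Continuous h' := hN.continuous.comp (by fun_prop)
  have hcell : ∀ κ : Fin (n + 1) × Fin (m + 1), ∃ C : ValleyCell J h',
      C.lo = (L (κ.1 - 1), M (κ.2 - 1)) ∧ C.up = (L κ.1, M κ.2) := by
    rintro ⟨i, j⟩
    obtain ⟨c, u, hu, hcu⟩ := hP.exists_velocity hN (Nat.lt_succ_iff.1 i.2)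
    obtain ⟨d, v, hv, hdv⟩ := hQ.exists_velocity hN (Nat.lt_succ_iff.1 j.2)
    refine hN.exists_valleyCell hu hv (c - d) _ _ fun w hw => ?_
    obtain ⟨⟨h1, h2⟩, h3, h4⟩ := hw
    have hL0 := hP.zero ▸ hLm (Nat.zero_le (i - 1))
    have hM0 := hQ.zero ▸ hMm (Nat.zero_le (j - 1))
    have hLn := hLm (Nat.lt_succ_iff.1 i.2)
    have hMn := hMm (Nat.lt_succ_iff.1 j.2)
    simp only at h1 h2 h3 h4
    simp only [hh']
    rw [hP' _ ⟨hL0.trans h1, h3.trans hLn⟩, hQ' _ ⟨hM0.trans h2, h4.trans hMn⟩, hcu _ ⟨h1, h3⟩,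
      hdv _ ⟨h2, h4⟩]
    congr 1
    module
  choose cell hlo hup using hcell
  have key := piecewiseQuadraticOn_optCost_of_grid hc (fun _ => hN.nonneg _) cell
    (fun i : Fin (n + 1) => L i) (fun j : Fin (m + 1) => M j) ((0 : ℝ), (0 : ℝ)) (L n, M m)
    (fun x y hx hxy hy h1 h2 => ?_) hle b₀ b₁ hb₁ hB
  · refine key.congr fun t ht => (optCost_congr fun w hw => ?_).symm
    have hd := (hB t ht).2
    simp only [hh']
    rw [hP' _ ⟨hw.1.1, hw.2.1.trans hd.1⟩, hQ' _ ⟨hw.1.2, hw.2.2.trans hd.2⟩]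
  · obtain ⟨i, hi1, hi2⟩ := exists_grid_interval hP.zero hx.1 hy.1 h1
    obtain ⟨j, hj1, hj2⟩ := exists_grid_interval hQ.zero hx.2 hy.2 h2
    refine ⟨(i, j), ?_⟩
    rw [hlo, hup]
    exact ⟨⟨⟨hi1, hj1⟩, hxy.1.trans hi2, hxy.2.trans hj2⟩, ⟨hi1.trans hxy.1, hj1.trans hxy.2⟩,
      hi2, hj2⟩

/-- Under a polygonal norm `N = G_{ψ(R_k)}` the optimum function
`t ↦ opt_h((0,0), B(t))` of every cell border `B` is piecewise quadratic, where
`h(z) = N(P(z₁) − Q(z₂))` for the unit-speed parametrizations `P, Q` of the two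
polygonal curves. -/
theorem optimum_function_piecewise_quadratic
    (k : ℕ) (hk : 4 ≤ k) (hke : Even k)
    (ψ : (ℝ × ℝ) →ₗ[ℝ] (ℝ × ℝ)) (hψ : Function.Bijective ψ)
    (N : ℝ × ℝ → ℝ) (hN : ∀ z : ℝ × ℝ, N z = gaugeFn (ψ '' Rgon k) z)
    (n m : ℕ) (p q : ℕ → ℝ × ℝ) (L M : ℕ → ℝ) (P Q : ℝ → ℝ × ℝ)
    (hP : IsUnitSpeedParam N n p L P) (hQ : IsUnitSpeedParam N m q M Q)
    (h : ℝ × ℝ → ℝ) (hh : ∀ z : ℝ × ℝ, h z = N (P z.1 - Q z.2))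
    (lo hi : ℝ) (B : ℝ → ℝ × ℝ) (hB : IsCellBorder n m L M lo hi B) :
    PiecewiseQuadraticOn (fun t => optCost h ((0 : ℝ), (0 : ℝ)) (B t)) lo hi := by
  obtain ⟨Φ, hΦ⟩ := exists_isPolyhedralNorm hk hke hψ hN
  have : Nonempty (Fin k) := ⟨⟨0, by omega⟩⟩
  obtain rfl : h = fun z => N (P z.1 - Q z.2) := funext hh
  have hL := hP.monotone hΦ
  have hM := hQ.monotone hΦ
  have hL0 : ∀ i, 0 ≤ L i := fun i => hP.zero ▸ hL (Nat.zero_le i)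
  have hM0 : ∀ i, 0 ≤ M i := fun i => hQ.zero ▸ hM (Nat.zero_le i)
  rcases hB with ⟨i, j, h1, hin, hjm, rfl, rfl, hB⟩ | ⟨i, j, hin, h1, hjm, rfl, rfl, hB⟩
  · obtain rfl : B = fun t => (0, M j) + t • (1, 0) := by
      ext t <;> simp [hB]
    refine piecewiseQuadraticOn_optCost_of_isUnitSpeedParam hΦ hP hQ (hL (Nat.sub_le i 1)) _ _
      (by simp [Prod.le_def]) fun t ht => ?_
    have h2 := (hL0 _).trans ht.1
    have h3 := ht.2.trans (hL hin)
    simpa [Prod.le_def, h2, h3, hM0] using hM hjm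
  · obtain rfl : B = fun t => (L i, 0) + t • (0, 1) := by
      ext t <;> simp [hB]
    refine piecewiseQuadraticOn_optCost_of_isUnitSpeedParam hΦ hP hQ (hM (Nat.sub_le j 1)) _ _
      (by simp [Prod.le_def]) fun t ht => ?_
    have h2 := (hM0 _).trans ht.1
    have h3 := ht.2.trans (hM hjm)
    simpa [Prod.le_def, h2, h3, hL0] using hL hin
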